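/- Let f be a Gaussian stationary process on T ∈ {ℤ, ℝ} with spectral measure ρ satisfying m₀ = 1 and m_δ < ∞ for some δ > 0. Assume ρ has a nontrivial absolutely continuous component (there exist ν > 0 and a bounded measurable set E ⊆ T* of positive Lebesgue measure with dρ ≥ ν·1_E(λ) dλ) and that m_{−γ} < ∞ for some γ ≥ 0. Then there exist N₀, C > 0 such that for all N > N₀: if γ < 1 then log P_f(N) ≤ −C N^{γ} log N; if γ = 1 then log P_f(N) ≤ −C N; and if γ > 1 then log P_f(N) ≤ −C(γ−1) N log N. -/

import Mathlib

open MeasureTheory ProbabilityTheory Real Set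
open scoped ENNReal NNReal

noncomputable section

/-- The `d`-th absolute spectral moment `m_d(ρ) = ∫ |λ|^d dρ(λ)`, valued in `[0,∞]`. -/
def specMom (ρ : Measure ℝ) (d : ℝ) : ℝ≥0∞ := ∫⁻ l, (ENNReal.ofReal |l|) ^ d ∂ρ

/-- `σ_N² = ρ([0, 1/N])`. -/
def sig2 (ρ : Measure ℝ) (N : ℝ) : ℝ := (ρ (Set.Icc 0 (1/N))).toReal

/-- `f` is a Gaussian stationary process on `ℝ` with spectral measure `ρ`, on the
probability space `(Ω, P)`: `ρ` is finite, symmetric and nonnegative; paths are a.s.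
continuous; and every finite linear combination `∑ aᵢ f(tᵢ)` is a centered Gaussian with
variance `∑ᵢⱼ aᵢ aⱼ r(tᵢ - tⱼ)` where `r(t) = ∫ cos(λ t) dρ(λ)`. -/
def IsGSPR {Ω : Type*} [MeasurableSpace Ω] (ρ : Measure ℝ) (P : Measure Ω)
    (f : ℝ → Ω → ℝ) : Prop :=
  IsFiniteMeasure ρ ∧ ρ.map (fun x => -x) = ρ ∧ IsProbabilityMeasure P ∧
  Measurable (fun p : ℝ × Ω => f p.1 p.2) ∧
  (∀ᵐ ω ∂P, Continuous fun t => f t ω) ∧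
  ∀ (n : ℕ) (t a : Fin n → ℝ),
    P.map (fun ω => ∑ i, a i * f (t i) ω)
      = gaussianReal 0 (∑ i, ∑ j, a i * a j * ∫ l, Real.cos (l * (t i - t j)) ∂ρ).toNNReal

/-- `f` is a Gaussian stationary process on `ℤ` with spectral measure `ρ` (supported on
`[-π,π]`), on the probability space `(Ω, P)`. -/
def IsGSPZ {Ω : Type*} [MeasurableSpace Ω] (ρ : Measure ℝ) (P : Measure Ω)
    (f : ℤ → Ω → ℝ) : Prop :=
  IsFiniteMeasure ρ ∧ ρ.map (fun x => -x) = ρ ∧ ρ (Set.Icc (-Real.pi) Real.pi)ᶜ = 0 ∧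
  IsProbabilityMeasure P ∧ (∀ n : ℤ, Measurable (f n)) ∧
  ∀ (n : ℕ) (t : Fin n → ℤ) (a : Fin n → ℝ),
    P.map (fun ω => ∑ i, a i * f (t i) ω)
      = gaussianReal 0
          (∑ i, ∑ j, a i * a j * ∫ l, Real.cos (l * ((t i : ℝ) - (t j : ℝ))) ∂ρ).toNNReal

/-- Persistence probability `P_f(N) = ℙ(f(t) > 0 ∀ t ∈ (0,N])` for a process on `ℝ`. -/
def persR {Ω : Type*} [MeasurableSpace Ω] (P : Measure Ω) (f : ℝ → Ω → ℝ) (N : ℝ) : ℝ :=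
  (P {ω | ∀ t ∈ Set.Ioc (0:ℝ) N, 0 < f t ω}).toReal

/-- Persistence probability `P_f(N) = ℙ(f(n) > 0 ∀ n ∈ (0,N] ∩ ℤ)` for a process on `ℤ`. -/
def persZ {Ω : Type*} [MeasurableSpace Ω] (P : Measure Ω) (f : ℤ → Ω → ℝ) (N : ℝ) : ℝ :=
  (P {ω | ∀ n : ℤ, 0 < n → (n : ℝ) ≤ N → 0 < f n ω}).toReal

/-- The standard Gaussian measure on `ℝ` (law of `Z ~ N(0,1)`). -/
def stdGauss : Measure ℝ := gaussianReal 0 1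


set_option linter.unusedSectionVars false

/-- squared modulus of a trigonometric sum -/
def TS {κ : Type*} (s : Finset κ) (a t : κ → ℝ) (l : ℝ) : ℝ :=
  (∑ i ∈ s, a i * Real.cos (l * t i)) ^ 2 + (∑ i ∈ s, a i * Real.sin (l * t i)) ^ 2

/-- generic Gaussian family -/
structure GP {ι Ω : Type*} [MeasurableSpace Ω] (τ : ι → ℝ) (ρ : Measure ℝ) (P : Measure Ω)
    (f : ι → Ω → ℝ) : Prop where
  meas : ∀ i, Measurable (f i)
  law : ∀ (n : ℕ) (t : Fin n → ι) (a : Fin n → ℝ),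
    P.map (fun ω => ∑ i, a i * f (t i) ω)
      = gaussianReal 0
        (∑ i, ∑ j, a i * a j * ∫ l, Real.cos (l * (τ (t i) - τ (t j))) ∂ρ).toNNReal

lemma TS_expand {κ : Type*} (s : Finset κ) (a t : κ → ℝ) (l : ℝ) :
    TS s a t l = ∑ i ∈ s, ∑ j ∈ s, a i * a j * Real.cos (l * (t i - t j)) := by
  unfold TS
  rw [sq, sq, Finset.sum_mul_sum, Finset.sum_mul_sum, ← Finset.sum_add_distrib]
  refine Finset.sum_congr rfl fun i _ => ?_
  rw [← Finset.sum_add_distrib]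
  refine Finset.sum_congr rfl fun j _ => ?_
  rw [mul_sub, Real.cos_sub]; ring

lemma TS_nonneg {κ : Type*} (s : Finset κ) (a t : κ → ℝ) (l : ℝ) : 0 ≤ TS s a t l := by
  unfold TS; positivity

lemma TS_cont {κ : Type*} (s : Finset κ) (a t : κ → ℝ) : Continuous (TS s a t) := by
  unfold TS; fun_prop

lemma integrable_cos (ρ : Measure ℝ) [IsFiniteMeasure ρ] (x : ℝ) :
    Integrable (fun l => Real.cos (l * x)) ρ := by
  refine Integrable.of_bound (C := 1) ?_ ?_
  · exact (by fun_prop : Continuous (fun l => Real.cos (l * x))).aestronglyMeasurable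
  · exact Filter.Eventually.of_forall fun l => by simpa using Real.abs_cos_le_one _

lemma TS_int {κ : Type*} (ρ : Measure ℝ) [IsFiniteMeasure ρ] (s : Finset κ) (a t : κ → ℝ) :
    Integrable (TS s a t) ρ := by
  have : TS s a t = fun l => ∑ i ∈ s, ∑ j ∈ s, a i * a j * Real.cos (l * (t i - t j)) :=
    funext fun l => TS_expand s a t l
  rw [this]
  exact integrable_finsetSum _ fun i _ => integrable_finsetSum _ fun j _ =>
    (integrable_cos ρ _).const_mul _

lemma TS_integral {κ : Type*} (ρ : Measure ℝ) [IsFiniteMeasure ρ] (s : Finset κ) (a t : κ → ℝ) :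
    ∫ l, TS s a t l ∂ρ
      = ∑ i ∈ s, ∑ j ∈ s, a i * a j * ∫ l, Real.cos (l * (t i - t j)) ∂ρ := by
  simp_rw [TS_expand]
  rw [integral_finsetSum _ fun i _ => integrable_finsetSum _ fun j _ =>
    (integrable_cos ρ _).const_mul _]
  refine Finset.sum_congr rfl fun i _ => ?_
  rw [integral_finsetSum _ fun j _ => (integrable_cos ρ _).const_mul _]
  refine Finset.sum_congr rfl fun j _ => ?_
  rw [integral_const_mul]

section gen
variable {ι Ω : Type*} [MeasurableSpace Ω] {τ : ι → ℝ} {ρ : Measure ℝ} {P : Measure Ω}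
    {f : ι → Ω → ℝ} [IsFiniteMeasure ρ] [IsProbabilityMeasure P]

lemma GP.law' (h : GP τ ρ P f) {κ : Type*} (s : Finset κ) (t : κ → ι) (a : κ → ℝ) :
    P.map (fun ω => ∑ i ∈ s, a i * f (t i) ω)
      = gaussianReal 0 (∫ l, TS s a (fun i => τ (t i)) l ∂ρ).toNNReal := by
  have e := s.equivFin.symm
  have := h.law s.card (fun i => t (e i)) (fun i => a (e i))
  rw [TS_integral]
  have h1 : ∀ g : κ → ℝ, ∑ i, g (e i) = ∑ i ∈ s, g i := by
    intro g
    rw [Equiv.sum_comp e (fun i : s => g i)]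
    exact Finset.sum_coe_sort s g
  have h2 : ∀ ω, ∑ i, a (e i) * f (t (e i)) ω = ∑ i ∈ s, a i * f (t i) ω := fun ω =>
    h1 (fun i => a i * f (t i) ω)
  simp_rw [h2] at this
  rw [this]
  congr 2
  rw [← h1 (fun i => ∑ j ∈ s, a i * a j * ∫ l, Real.cos (l * (τ (t i) - τ (t j))) ∂ρ)]
  refine Finset.sum_congr rfl fun i _ => ?_
  rw [← h1 (fun j => a (e i) * a j * ∫ l, Real.cos (l * (τ (t (e i)) - τ (t j))) ∂ρ)]

lemma GP.gproc (h : GP τ ρ P f) : IsGaussianProcess f P where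
  hasGaussianLaw I := by
    classical
    refine ⟨isGaussian_of_map_eq_gaussianReal fun L => ?_⟩
    have hm : Measurable (fun ω => I.restrict (f · ω)) :=
      measurable_pi_lambda _ fun i => h.meas i
    rw [Measure.map_map (by fun_prop) hm]
    have : (⇑L ∘ fun ω => I.restrict fun x => f x ω)
        = fun ω => ∑ i ∈ (Finset.univ : Finset I), L (Pi.single i 1) * f i ω := by
      funext ω
      simp only [Function.comp]
      conv_lhs => rw [pi_eq_sum_univ' (I.restrict fun x => f x ω)]
      rw [map_sum]
      refine Finset.sum_congr rfl fun i _ => ?_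
      rw [map_smul, smul_eq_mul, mul_comm]
      congr 2
    rw [this]
    exact ⟨0, _, h.law' Finset.univ (fun i : I => (i : ι)) _⟩

lemma GP.variance_eq (h : GP τ ρ P f) {κ : Type*} (s : Finset κ) (t : κ → ι) (a : κ → ℝ) :
    Var[fun ω => ∑ i ∈ s, a i * f (t i) ω; P] = ∫ l, TS s a (fun i => τ (t i)) l ∂ρ := by
  have h1 := h.law' s t a
  have hm : AEMeasurable (fun ω => ∑ i ∈ s, a i * f (t i) ω) P :=
    (Finset.measurable_fun_sum _ fun i _ => (h.meas _).const_mul _).aemeasurable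
  have h2 := variance_id_gaussianReal (μ := 0)
    (v := (∫ l, TS s a (fun i => τ (t i)) l ∂ρ).toNNReal)
  rw [← h1, variance_id_map hm] at h2
  rw [h2, Real.coe_toNNReal _ (integral_nonneg fun l => TS_nonneg _ _ _ _)]

lemma GP.memLp (h : GP τ ρ P f) (i : ι) : MemLp (f i) 2 P :=
  (h.gproc.hasGaussianLaw_eval i).memLp_two

lemma GP.mean (h : GP τ ρ P f) (i : ι) : P[f i] = 0 := by
  have h1 := h.law' {()} (fun _ => i) (fun _ => 1)
  simp only [Finset.sum_singleton, one_mul] at h1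
  have := integral_id_gaussianReal (μ := 0)
    (v := (∫ l, TS {()} (fun _ => 1) (fun _ => τ i) l ∂ρ).toNNReal)
  rw [← h1, integral_map (h.meas i).aemeasurable (by fun_prop)] at this
  exact this

lemma GP.cov (h : GP τ ρ P f) (i j : ι) :
    cov[f i, f j; P] = ∫ l, Real.cos (l * (τ i - τ j)) ∂ρ := by
  have h0 : ∀ i, Var[f i; P] = ∫ l, Real.cos (l * (τ i - τ i)) ∂ρ := fun i => by
    have := h.variance_eq {()} (fun _ => i) (fun _ => 1)
    simpa [TS_integral] using this
  have h1 := h.variance_eq (Finset.univ : Finset Bool) (fun b => if b then i else j) (fun _ => 1)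
  rw [TS_integral] at h1
  simp only [Fintype.univ_bool, Finset.mem_singleton, Bool.true_eq_false, not_false_eq_true,
    Finset.sum_insert, Finset.sum_singleton, if_true, one_mul, Bool.false_eq_true, if_false] at h1
  have h2 := variance_fun_add (h.memLp i) (h.memLp j)
  rw [h1, h0 i, h0 j] at h2
  have h3 : ∀ l : ℝ, Real.cos (l * (τ j - τ i)) = Real.cos (l * (τ i - τ j)) := fun l => by
    rw [← Real.cos_neg]; ring_nf
  simp_rw [h3] at h2
  linarith

end gen

section genB
variable {ι Ω : Type*} [MeasurableSpace Ω] {τ : ι → ℝ} {ρ : Measure ℝ} {P : Measure Ω}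
    {f : ι → Ω → ℝ} [IsFiniteMeasure ρ] [IsProbabilityMeasure P]

/-- regression coefficients -/
lemma exists_regress {k : ℕ} (X : Fin k → Ω → ℝ) (Y : Ω → ℝ) (hX : ∀ i, MemLp (X i) 2 P)
    (hY : MemLp Y 2 P) (h0 : ∀ i, P[X i] = 0) :
    ∃ c : Fin k → ℝ, ∀ i, cov[fun ω => Y ω - ∑ j, c j * X j ω, X i; P] = 0 := by
  let x : Fin k → Lp ℝ 2 P := fun i => (hX i).toLp
  let y : Lp ℝ 2 P := hY.toLp
  let W : Submodule ℝ (Lp ℝ 2 P) := Submodule.span ℝ (Set.range x)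
  haveI : FiniteDimensional ℝ W := FiniteDimensional.span_of_finite ℝ (Set.finite_range x)
  have hp : (W.starProjection y) ∈ W := Submodule.starProjection_apply_mem W y
  obtain ⟨c, hc⟩ := (Submodule.mem_span_range_iff_exists_fun ℝ).1 hp
  refine ⟨c, fun i => ?_⟩
  have h1 : inner ℝ (y - W.starProjection y) (x i) = 0 :=
    Submodule.starProjection_inner_eq_zero y (x i) (Submodule.subset_span ⟨i, rfl⟩)
  rw [← hc] at h1
  have hZ : MemLp (fun ω => Y ω - ∑ j, c j * X j ω) 2 P :=
    hY.sub (memLp_finsetSum _ fun j _ => (hX j).const_mul (c j))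
  rw [covariance_eq_sub hZ (hX i), h0 i, mul_zero, sub_zero]
  rw [L2.inner_def] at h1
  rw [← h1]
  refine integral_congr_ae ?_
  have e1 := Lp.coeFn_sub y (∑ j, c j • x j)
  have e2 : ⇑(∑ j, c j • x j) =ᵐ[P] fun ω => ∑ j, c j * X j ω := by
    have h3 := Lp.coeFn_finsetSum (Finset.univ) (fun j => c j • x j)
    have h4 : ∀ j, ⇑(c j • x j) =ᵐ[P] fun ω => c j * X j ω := fun j => by
      filter_upwards [Lp.coeFn_smul (c j) (x j), (hX j).coeFn_toLp] with ω h5 h6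
      rw [h5, Pi.smul_apply, h6, smul_eq_mul]
    filter_upwards [h3, eventually_countable_forall.2 h4] with ω h5 h6
    rw [h5]; simp [h6]
  filter_upwards [e1, e2, hY.coeFn_toLp, (hX i).coeFn_toLp] with ω a1 a2 a3 a4
  rw [a1, Pi.sub_apply, a2, a3, a4]
  simp [mul_comm]

lemma seq_bound (h : GP τ ρ P f) (t : ℕ → ι) (m : ℕ) (v₀ : ℝ)
    (hv : ∀ k < m, ∀ a : ℕ → ℝ, a k = 1 →
      v₀ ≤ ∫ l, TS (Finset.range (k+1)) a (fun i => τ (t i)) l ∂ρ)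
    (g : ℝ → ℝ≥0∞) (hg : Measurable g) (B : ℝ≥0∞)
    (hB : ∀ (L : ℝ) (v : ℝ≥0), v₀ ≤ v → ∫⁻ x, g (L + x) ∂(gaussianReal 0 v) ≤ B) :
    ∫⁻ ω, ∏ k ∈ Finset.range m, g (f (t k) ω) ∂P ≤ B ^ m := by
  induction m with
  | zero => simp
  | succ k ih =>
    have ih := ih fun j hj => hv j (by omega)
    obtain ⟨c, hc⟩ := exists_regress (P := P) (fun i : Fin k => f (t i)) (f (t k))
      (fun i => h.memLp _) (h.memLp _) (fun i => h.mean _)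
    set Z : Ω → ℝ := fun ω => f (t k) ω - ∑ j, c j * f (t j) ω with hZ
    let a : ℕ → ℝ := fun j => if hj : j < k then - c ⟨j, hj⟩ else 1
    have hZa : Z = fun ω => ∑ j ∈ Finset.range (k+1), a j * f (t j) ω := by
      funext ω
      rw [Finset.sum_range_succ, Finset.sum_range]
      simp only [a, hZ, Fin.is_lt, dif_pos, lt_irrefl, dif_neg, not_false_eq_true, Fin.eta]
      simp [Finset.sum_neg_distrib]; ring
    have hZlaw := h.law' (Finset.range (k+1)) t a
    rw [← hZa] at hZlaw
    set v := (∫ l, TS (Finset.range (k+1)) a (fun i => τ (t i)) l ∂ρ).toNNReal with hvdef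
    have hv0 : v₀ ≤ v := (hv k (by omega) a (by simp [a])).trans (Real.le_coe_toNNReal _)
    have hZm : Measurable Z := by
      rw [hZa]; exact Finset.measurable_fun_sum _ fun i _ => (h.meas _).const_mul _
    have hind : IndepFun (fun ω (i : Fin k) => f (t i) ω) (fun ω (_ : Unit) => Z ω) P := by
      refine IsGaussianProcess.indepFun_of_covariance_eq_zero
        (X := fun (i : Fin k) => f (t i)) (Y := fun (_ : Unit) => Z) ?_
        (fun i => (h.meas _).aemeasurable) (fun _ => hZm.aemeasurable) ?_
      · refine IsGaussianProcess.of_isGaussianProcess h.gproc fun s => ?_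
        classical
        rcases s with i | u
        · exact ⟨{t i}, ContinuousLinearMap.proj (R := ℝ) (φ := fun _ => ℝ) ⟨t i, by simp⟩, fun ω => rfl⟩
        · refine ⟨(Finset.range (k+1)).image t,
            ∑ j ∈ (Finset.range (k+1)).attach, a j •
              ContinuousLinearMap.proj (R := ℝ) (φ := fun _ => ℝ)
              ⟨t j, Finset.mem_image_of_mem t j.2⟩, fun ω => ?_⟩
          simp only [Sum.elim_inr, hZa]
          rw [ContinuousLinearMap.sum_apply]
          simp only [ContinuousLinearMap.smul_apply, ContinuousLinearMap.proj_apply, smul_eq_mul,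
            Finset.restrict]
          exact (Finset.sum_attach (Finset.range (k+1)) (fun j => a j * f (t j) ω)).symm
      · intro s _
        rw [covariance_comm]; exact hc s
    have hind2 : IndepFun (fun ω (i : Fin k) => f (t i) ω) Z P :=
      hind.comp (φ := id) (ψ := fun u : Unit → ℝ => u ()) measurable_id (measurable_pi_apply _)
    have hXm : Measurable (fun ω (i : Fin k) => f (t i) ω) :=
      measurable_pi_lambda _ fun i => h.meas _
    have hmap := (indepFun_iff_map_prod_eq_prod_map_map hXm.aemeasurable hZm.aemeasurable).1 hind2
    have hF : Measurable (fun p : (Fin k → ℝ) × ℝ =>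
        (∏ i, g (p.1 i)) * g ((∑ j, c j * p.1 j) + p.2)) := by fun_prop
    have hrw : ∀ ω, ∏ j ∈ Finset.range (k+1), g (f (t j) ω)
        = (fun p : (Fin k → ℝ) × ℝ => (∏ i, g (p.1 i)) * g ((∑ j, c j * p.1 j) + p.2))
          ((fun i : Fin k => f (t i) ω), Z ω) := by
      intro ω
      rw [Finset.prod_range_succ, Finset.prod_range]
      simp [hZ]
    simp_rw [hrw]
    rw [← lintegral_map (f := fun p : (Fin k → ℝ) × ℝ =>
        (∏ i, g (p.1 i)) * g ((∑ j, c j * p.1 j) + p.2)) hF (hXm.prodMk hZm), hmap,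
      lintegral_prod _ hF.aemeasurable]
    calc _ ≤ ∫⁻ x, (∏ i, g (x i)) * B ∂(P.map (fun ω (i : Fin k) => f (t i) ω)) := by
          refine lintegral_mono fun x => ?_
          simp only
          rw [lintegral_const_mul _ (by fun_prop), hZlaw]
          gcongr
          exact hB _ v hv0
      _ ≤ B ^ k * B := by
          rw [lintegral_mul_const _ (by fun_prop), lintegral_map (by fun_prop) hXm]
          gcongr
          refine le_trans (le_of_eq ?_) ih
          refine lintegral_congr fun ω => ?_
          rw [Finset.prod_range]
      _ = B ^ (k+1) := (pow_succ _ _).symm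
end genB

lemma greedy_step {H : Type*} [NormedAddCommGroup H] [InnerProductSpace ℝ H] {n : ℕ} (hn : 0 < n)
    (v : Fin n → H) (B α : ℝ) (hB0 : 0 ≤ B)
    (hB : ∀ c : Fin n → ℝ, ‖∑ i, c i • v i‖ ^ 2 ≤ B * ∑ i, c i ^ 2)
    (hα : ∀ i, ‖v i‖ ^ 2 = α) (W : Submodule ℝ H) [FiniteDimensional ℝ W] :
    ∃ i, ∀ w ∈ W, α - B * Module.finrank ℝ W / n ≤ ‖v i - w‖ ^ 2 := by
  have bess : ∀ u : H, ∑ i, inner ℝ (v i) u ^ 2 ≤ B * ‖u‖ ^ 2 := by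
    intro u
    set S := ∑ i, inner ℝ (v i) u ^ 2 with hS
    have hS0 : 0 ≤ S := Finset.sum_nonneg fun i _ => sq_nonneg _
    have h1 : S = inner ℝ (∑ i, inner ℝ (v i) u • v i) u := by
      rw [sum_inner, hS]
      refine Finset.sum_congr rfl fun i _ => ?_
      rw [real_inner_smul_left]; ring
    have h2 := hB fun i => inner ℝ (v i) u
    have h3 := real_inner_le_norm (∑ i, inner ℝ (v i) u • v i) u
    rw [← h1] at h3
    have h4 : S ^ 2 ≤ B * S * ‖u‖ ^ 2 := by
      calc S ^ 2 ≤ (‖∑ i, inner ℝ (v i) u • v i‖ * ‖u‖) ^ 2 := by gcongr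
        _ = ‖∑ i, inner ℝ (v i) u • v i‖ ^ 2 * ‖u‖ ^ 2 := by ring
        _ ≤ _ := by gcongr
    rcases hS0.eq_or_lt with h5 | h5
    · rw [← h5]; positivity
    · nlinarith
  have hproj : ∑ i, ‖W.starProjection (v i)‖ ^ 2 ≤ B * Module.finrank ℝ W := by
    let u := stdOrthonormalBasis ℝ W
    have h1 : ∀ i, ‖W.starProjection (v i)‖ ^ 2 = ∑ j, inner ℝ (v i) (u j : H) ^ 2 := by
      intro i
      have := u.sum_sq_norm_inner_right (W.orthogonalProjectionOnto (v i))
      rw [Submodule.starProjection_apply, ← Submodule.coe_norm, ← this]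
      refine Finset.sum_congr rfl fun j _ => ?_
      rw [Submodule.inner_orthogonalProjectionOnto_eq_of_mem_left, Real.norm_eq_abs, sq_abs,
        real_inner_comm]
    simp_rw [h1]
    rw [Finset.sum_comm]
    calc _ ≤ ∑ j, B * ‖(u j : H)‖ ^ 2 := Finset.sum_le_sum fun j _ => bess _
      _ = ∑ j : Fin (Module.finrank ℝ W), B := by
          refine Finset.sum_congr rfl fun j _ => ?_
          have : ‖u j‖ = 1 := u.norm_eq_one j
          rw [← Submodule.coe_norm, this]; ring
      _ = _ := by simp [mul_comm]
  have : ∃ i, ‖W.starProjection (v i)‖ ^ 2 ≤ B * Module.finrank ℝ W / n := by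
    by_contra! hcon
    have hne : (Finset.univ : Finset (Fin n)).Nonempty := ⟨⟨0, hn⟩, Finset.mem_univ _⟩
    have h2 := Finset.sum_lt_sum_of_nonempty hne fun i _ => hcon i
    rw [Finset.sum_const, Finset.card_univ, Fintype.card_fin, nsmul_eq_mul,
      mul_div_cancel₀] at h2
    · linarith
    · positivity
  obtain ⟨i, hi⟩ := this
  refine ⟨i, fun w hw => ?_⟩
  have h1 : ‖v i - w‖ ^ 2 = ‖v i - W.starProjection (v i)‖ ^ 2 + ‖W.starProjection (v i) - w‖ ^ 2 := by
    have h0 : inner ℝ (v i - W.starProjection (v i)) (W.starProjection (v i) - w) = 0 :=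
      Submodule.starProjection_inner_eq_zero _ _
        (W.sub_mem (Submodule.starProjection_apply_mem W _) hw)
    have := norm_add_sq_real (v i - W.starProjection (v i)) (W.starProjection (v i) - w)
    rw [h0] at this
    rw [sub_add_sub_cancel] at this
    linarith
  have h2 : ‖v i‖ ^ 2 = ‖v i - W.starProjection (v i)‖ ^ 2 + ‖W.starProjection (v i)‖ ^ 2 := by
    have h0 : inner ℝ (v i - W.starProjection (v i)) (W.starProjection (v i)) = 0 :=
      Submodule.starProjection_inner_eq_zero _ _ (Submodule.starProjection_apply_mem W _)
    have := norm_add_sq_real (v i - W.starProjection (v i)) (W.starProjection (v i))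
    rw [h0, sub_add_cancel] at this
    linarith
  have h3 := hα i
  nlinarith [sq_nonneg ‖W.starProjection (v i) - w‖]

lemma int_cos_orth (s : ℝ) (hs : 0 < s) (k : ℤ) (hk : k ≠ 0) :
    ∫ l in Set.Icc (-(π / s)) (π / s), Real.cos (l * (s * k)) = 0 := by
  have hk' : (s * k : ℝ) ≠ 0 := mul_ne_zero hs.ne' (by exact_mod_cast hk)
  have hle : -(π / s) ≤ π / s := by have := div_pos pi_pos hs; linarith
  rw [integral_Icc_eq_integral_Ioc, ← intervalIntegral.integral_of_le hle,
    intervalIntegral.integral_comp_mul_right (fun x => Real.cos x) hk', integral_cos]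
  have : π / s * (s * k) = k * π := by field_simp
  rw [neg_mul, this, Real.sin_neg, Real.sin_int_mul_pi]; simp

lemma bessel_TS (s : ℝ) (hs : 0 < s) (E : Set ℝ) 
    (hsub : E ⊆ Set.Icc (-(π / s)) (π / s)) (n : ℕ) (c : Fin n → ℝ) :
    ∫ l in E, TS Finset.univ c (fun i : Fin n => s * (i : ℝ)) l ≤ (2 * π / s) * ∑ i, c i ^ 2 := by
  have h1 : ∫ l in E, TS Finset.univ c (fun i : Fin n => s * (i : ℝ)) l
      ≤ ∫ l in Set.Icc (-(π / s)) (π / s), TS Finset.univ c (fun i : Fin n => s * (i : ℝ)) l :=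
    setIntegral_mono_set (TS_int _ _ _ _) (Filter.Eventually.of_forall fun l => TS_nonneg _ _ _ _)
      (Filter.Eventually.of_forall hsub)
  refine h1.trans (le_of_eq ?_)
  rw [TS_integral, Finset.mul_sum]
  refine Finset.sum_congr rfl fun i _ => ?_
  rw [Finset.sum_eq_single i]
  · have hle : 0 ≤ π / s := (div_pos pi_pos hs).le
    simp [hle]
    ring
  · intro j _ hij
    have := int_cos_orth s hs ((i : ℤ) - (j : ℤ)) (by
      rw [sub_ne_zero]; intro h; apply hij; ext; exact_mod_cast h.symm)
    push_cast at this
    rw [← mul_sub, this, mul_zero]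
  · simp

lemma greedy_seq (s : ℝ) (hs : 0 < s) (E : Set ℝ)
    (hsub : E ⊆ Set.Icc (-(π / s)) (π / s)) (n : ℕ) (hn : 0 < n) (m : ℕ)
    (hm : (2 * π / s) * m ≤ (volume.real E / 2) * n) :
    ∃ σ : ℕ → Fin n, ∀ k < m, ∀ a : ℕ → ℝ, a k = 1 →
      volume.real E / 2 ≤ ∫ l in E, TS (Finset.range (k+1)) a (fun i => s * (σ i : ℝ)) l := by
  classical
  have hEf : IsFiniteMeasure (volume.restrict E) := by
    refine ⟨?_⟩
    rw [Measure.restrict_apply_univ]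
    exact (measure_mono hsub).trans_lt (by simp)
  let G : Matrix (Fin n) (Fin n) ℝ := fun i j => ∫ l in E, Real.cos (l * (s * i - s * j))
  have hG : G.PosSemidef := by
    refine Matrix.PosSemidef.of_dotProduct_mulVec_nonneg ?_ ?_
    · ext i j
      rw [Matrix.conjTranspose_apply, star_trivial]
      refine integral_congr_ae (Filter.Eventually.of_forall fun l => ?_)
      simp only
      rw [← Real.cos_neg]; ring_nf
    · intro x
      have h1 : 0 ≤ ∫ l in E, TS Finset.univ x (fun i : Fin n => s * (i : ℝ)) l :=
        integral_nonneg fun l => TS_nonneg _ _ _ _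
      rw [TS_integral] at h1
      refine h1.trans_eq ?_
      simp only [dotProduct, Matrix.mulVec, star_trivial, Finset.mul_sum, G, Pi.star_apply]
      refine Finset.sum_congr rfl fun i _ => Finset.sum_congr rfl fun j _ => ?_
      ring
  obtain ⟨M, Bm, hBm⟩ := Matrix.posSemidef_iff_eq_sum_vecMulVec.1 hG
  let v : Fin n → EuclideanSpace ℝ (Fin M) := fun i => WithLp.toLp 2 (fun k => Bm k i)
  have hv : ∀ i j, inner ℝ (v i) (v j) = G i j := by
    intro i j
    rw [hBm]
    simp [v, Matrix.sum_apply, Matrix.vecMulVec_apply, PiLp.inner_apply, mul_comm]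
  have hnorm : ∀ {κ : Type} (S : Finset κ) (c : κ → ℝ) (σ : κ → Fin n),
      ‖∑ i ∈ S, c i • v (σ i)‖ ^ 2 = ∫ l in E, TS S c (fun i => s * (σ i : ℝ)) l := by
    intro κ S c σ
    rw [TS_integral, ← real_inner_self_eq_norm_sq, sum_inner]
    refine Finset.sum_congr rfl fun i _ => ?_
    rw [inner_sum]
    refine Finset.sum_congr rfl fun j _ => ?_
    rw [real_inner_smul_left, real_inner_smul_right, hv]; simp only [G]; ring
  have hα : ∀ i, ‖v i‖ ^ 2 = volume.real E := by
    intro i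
    rw [← real_inner_self_eq_norm_sq, hv]
    simp [G]
  have hB : ∀ c : Fin n → ℝ, ‖∑ i, c i • v i‖ ^ 2 ≤ (2 * π / s) * ∑ i, c i ^ 2 := by
    intro c
    refine (hnorm Finset.univ c (fun i => i)).trans_le ?_
    exact bessel_TS s hs E hsub n c
  induction m with
  | zero => exact ⟨fun _ => ⟨0, hn⟩, fun k hk => absurd hk (by omega)⟩
  | succ m ih =>
    have h2 : 0 < 2 * π / s := by positivity
    push_cast at hm
    obtain ⟨σ, hσ⟩ := ih (by nlinarith)
    let W : Submodule ℝ (EuclideanSpace ℝ (Fin M)) :=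
      Submodule.span ℝ ((Finset.range m).image (fun j => v (σ j)) : Finset _)
    obtain ⟨i, hi⟩ := greedy_step hn v (2 * π / s) _ h2.le hB hα W
    have hfr : (Module.finrank ℝ W : ℝ) ≤ m := by
      have := (finrank_span_finset_le_card (R := ℝ)
        ((Finset.range m).image (fun j => v (σ j)))).trans Finset.card_image_le
      rw [Finset.card_range] at this
      exact_mod_cast this
    refine ⟨Function.update σ m i, fun k hk a hak => ?_⟩
    rw [← hnorm]
    rcases Nat.lt_succ_iff_lt_or_eq.1 hk with hk | rfl
    · have := hσ k hk a hak
      rw [← hnorm] at this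
      convert this using 5 with j hj
      rw [Function.update_of_ne]
      have := Finset.mem_range.1 hj
      omega
    · rw [Finset.sum_range_succ, Function.update_self, hak, one_smul]
      have hw : (∑ x ∈ Finset.range k, a x • v (Function.update σ k i x)) ∈ W := by
        refine W.sum_mem fun x hx => W.smul_mem _ ?_
        rw [Function.update_of_ne (by have := Finset.mem_range.1 hx; omega)]
        exact Submodule.subset_span (Finset.mem_coe.2 (Finset.mem_image_of_mem _ hx))
      have h5 := hi _ (W.neg_mem hw)
      rw [sub_neg_eq_add, add_comm] at h5
      refine le_trans ?_ h5
      have hn' : (0:ℝ) < n := by exact_mod_cast hn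
      have : 2 * π / s * Module.finrank ℝ W / n ≤ volume.real E / 2 := by
        rw [div_le_iff₀ hn']
        nlinarith
      linarith

/-- one-sided exponential weight -/
def gw (θ : ℝ) (x : ℝ) : ℝ≥0∞ := Set.indicator (Set.Ioi 0) (fun x => ENNReal.ofReal (Real.exp (-θ * x))) x

lemma gw_meas (θ : ℝ) : Measurable (gw θ) := by
  unfold gw
  exact Measurable.indicator (by fun_prop) measurableSet_Ioi

lemma gauss_bound_one (v₀ : ℝ) (hv₀ : 0 < v₀) (θ : ℝ) (hθ : 0 < θ) (L : ℝ) (v : ℝ≥0)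
    (hv : v₀ ≤ v) :
    ∫⁻ x, gw θ (L + x) ∂(gaussianReal 0 v) ≤ ENNReal.ofReal (1 / (θ * √v₀)) := by
  have hvpos : (0:ℝ) < v := hv₀.trans_le hv
  have hv0 : v ≠ 0 := by rintro rfl; simp at hvpos
  rw [gaussianReal_of_var_ne_zero 0 hv0,
    lintegral_withDensity_eq_lintegral_mul _ (measurable_gaussianPDF 0 v)
      (show Measurable (fun x => gw θ (L + x)) from (gw_meas θ).comp (measurable_const_add L))]
  have h1 : ∀ x, gaussianPDF 0 v x ≤ ENNReal.ofReal (1 / √v₀) := by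
    intro x
    unfold gaussianPDF
    refine ENNReal.ofReal_le_ofReal ?_
    rw [gaussianPDFReal_def]
    simp only
    have h2 : Real.exp (-(x - 0) ^ 2 / (2 * v)) ≤ 1 := by
      rw [Real.exp_le_one_iff]
      apply div_nonpos_of_nonpos_of_nonneg
      · nlinarith [sq_nonneg (x-0)]
      · positivity
    have h3 : (√(2 * π * v))⁻¹ ≤ 1 / √v₀ := by
      rw [← one_div]
      apply one_div_le_one_div_of_le (Real.sqrt_pos.2 hv₀)
      apply Real.sqrt_le_sqrt
      nlinarith [pi_gt_three]
    calc _ ≤ (√(2 * π * v))⁻¹ * 1 := by gcongr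
      _ ≤ _ := by rw [mul_one]; exact h3
  calc _ ≤ ∫⁻ x, ENNReal.ofReal (1 / √v₀) * gw θ (L + x) := by
        refine lintegral_mono fun x => ?_
        simp only [Pi.mul_apply, Function.comp]
        gcongr
        exact h1 x
    _ = ENNReal.ofReal (1 / √v₀) * ∫⁻ x, gw θ x := by
        rw [lintegral_const_mul _ (show Measurable (fun x => gw θ (L + x)) from (gw_meas θ).comp (measurable_const_add L)),
          lintegral_add_left_eq_self]
    _ = _ := by
        unfold gw
        rw [lintegral_indicator measurableSet_Ioi,
          ← ofReal_integral_eq_lintegral_ofReal (exp_neg_integrableOn_Ioi 0 hθ)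
            (Filter.Eventually.of_forall fun x => (Real.exp_pos _).le),
          integral_exp_mul_Ioi (by linarith) 0,
          ← ENNReal.ofReal_mul (by positivity)]
        congr 1
        simp

lemma gauss_half (v : ℝ≥0) : 1 ≤ 2 * (gaussianReal 0 v) (Set.Ici 0) := by
  have h1 : (gaussianReal 0 v) (Set.Iic 0) = (gaussianReal 0 v) (Set.Ici 0) := by
    have := gaussianReal_map_neg (μ := 0) (v := v)
    rw [neg_zero] at this
    conv_lhs => rw [← this]
    rw [Measure.map_apply measurable_neg measurableSet_Iic]
    congr 1; ext x; simp
  have h2 : (1 : ℝ≥0∞) ≤ (gaussianReal 0 v) (Set.Iic 0) + (gaussianReal 0 v) (Set.Ici 0) := by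
    rw [← measure_univ (μ := gaussianReal 0 v)]
    refine le_trans (measure_mono ?_) (measure_union_le _ _)
    intro x _
    exact le_total x 0
  rw [h1] at h2
  rw [two_mul]; exact h2

lemma gauss_tail (v₀ : ℝ) (hv₀ : 0 < v₀) (v : ℝ≥0) (hv : v₀ ≤ v) (y : ℝ) (hy : 0 ≤ y) :
    ENNReal.ofReal (Real.exp (-1 - (y / √v₀) ^ 2) / 3) ≤ (gaussianReal 0 v) (Set.Iic (-y)) := by
  have hvpos : (0:ℝ) < v := hv₀.trans_le hv
  have hs0 : 0 < √v₀ := Real.sqrt_pos.2 hv₀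
  have hs : √v₀ ≤ √(v:ℝ) := Real.sqrt_le_sqrt hv
  have hsv : 0 < √(v:ℝ) := Real.sqrt_pos.2 hvpos
  set z := y / √v₀ with hz
  have hz0 : 0 ≤ z := by positivity
  have hmap : gaussianReal 0 v = (gaussianReal 0 1).map (fun x => √(v:ℝ) * x) := by
    rw [gaussianReal_map_const_mul]
    congr 1
    · simp
    · ext; simp
  have h1 : (gaussianReal 0 1) (Set.Icc (-z-1) (-z)) ≤ (gaussianReal 0 v) (Set.Iic (-y)) := by
    rw [hmap, Measure.map_apply (by fun_prop) measurableSet_Iic]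
    refine measure_mono fun x hx => ?_
    simp only [Set.mem_preimage, Set.mem_Iic]
    have : y = z * √v₀ := by rw [hz]; field_simp
    have hx2 := hx.2
    nlinarith
  refine le_trans ?_ h1
  rw [gaussianReal_apply 0 one_ne_zero]
  have h2 : ∀ x ∈ Set.Icc (-z-1) (-z), ENNReal.ofReal (Real.exp (-1 - z ^ 2) / 3) ≤ gaussianPDF 0 1 x := by
    intro x hx
    unfold gaussianPDF
    refine ENNReal.ofReal_le_ofReal ?_
    rw [gaussianPDFReal_def]
    simp only [NNReal.coe_one, mul_one, sub_zero]
    have h3 : (1:ℝ)/3 ≤ (√(2 * π))⁻¹ := by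
      rw [← one_div]
      apply one_div_le_one_div_of_le (by positivity)
      rw [Real.sqrt_le_left (by norm_num)]
      nlinarith [pi_lt_four]
    have h4 : Real.exp (-1 - z^2) ≤ Real.exp (-x^2/2) := by
      apply Real.exp_le_exp.2
      have : x ^ 2 ≤ (z+1)^2 := by
        apply sq_le_sq'
        · linarith [hx.1]
        · linarith [hx.2]
      nlinarith [sq_nonneg (z-1)]
    calc _ = 1/3 * Real.exp (-1 - z^2) := by ring
      _ ≤ _ := by gcongr
  calc _ = ∫⁻ x in Set.Icc (-z-1) (-z), ENNReal.ofReal (Real.exp (-1 - z ^ 2) / 3) := by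
        simp
    _ ≤ _ := setLIntegral_mono (measurable_gaussianPDF 0 1) h2

lemma exp_aux1 (θ : ℝ) (h0 : 0 ≤ θ) (h1 : θ ≤ 1/12) : Real.exp θ ≤ 1 + θ + θ^2 := by
  have := Real.abs_exp_sub_one_sub_id_le (x := θ) (by rw [abs_of_nonneg h0]; linarith)
  have := abs_le.1 this
  linarith [this.2]

lemma gauss_bound_two (v₀ : ℝ) (hv₀ : 0 < v₀) (q : ℝ) (hq : 0 < q) (ε : ℝ)
    (hε : ε = Real.exp (-1 - (3 * q / √v₀) ^ 2) / 3) (L : ℝ) (v : ℝ≥0) (hv : v₀ ≤ v) :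
    ∫⁻ x, gw (ε / 4 / q) (L + x) ∂(gaussianReal 0 v)
      ≤ ENNReal.ofReal (Real.exp (-(ε/4) - ε/16)) := by
  have hε0 : 0 < ε := by rw [hε]; positivity
  have hε1 : ε ≤ 1/3 := by
    rw [hε]
    have : Real.exp (-1 - (3 * q / √v₀) ^ 2) ≤ 1 := by
      rw [Real.exp_le_one_iff]; nlinarith [sq_nonneg (3 * q / √v₀)]
    linarith
  set θ := ε / 4 with hθ
  have hθ0 : 0 < θ := by positivity
  have hθ1 : θ ≤ 1/12 := by rw [hθ]; linarith
  have e1 := exp_aux1 θ hθ0.le hθ1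
  have e16 : 1 - ε/16 ≤ Real.exp (-(ε/16)) := by
    have := Real.add_one_le_exp (-(ε/16)); linarith
  have gle : ∀ x, gw (θ / q) x ≤ 1 := by
    intro x
    unfold gw
    by_cases hx : x ∈ Set.Ioi (0:ℝ)
    · rw [Set.indicator_of_mem hx]
      rw [ENNReal.ofReal_le_one, Real.exp_le_one_iff]
      have : (0:ℝ) < x := hx
      have : 0 < θ / q * x := by positivity
      linarith
    · rw [Set.indicator_of_notMem hx]; exact zero_le
  rcases le_total L (3 * q) with hL | hL
  · have h1 : ∀ x, gw (θ/q) (L + x) ≤ Set.indicator (Set.Ioi (-(3*q))) 1 x := by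
      intro x
      by_cases hx : x ∈ Set.Ioi (-(3*q))
      · rw [Set.indicator_of_mem hx]; exact gle _
      · rw [Set.indicator_of_notMem hx]
        have : ¬ (-(3*q) < x) := hx
        unfold gw
        rw [Set.indicator_of_notMem]
        simp only [Set.mem_Ioi]; linarith
    have h2 : ∫⁻ x, gw (θ/q) (L + x) ∂(gaussianReal 0 v) ≤ (gaussianReal 0 v) (Set.Ioi (-(3*q))) := by
      refine (lintegral_mono h1).trans ?_
      rw [lintegral_indicator_one measurableSet_Ioi]
    refine h2.trans ?_
    have h3 : Set.Ioi (-(3*q)) = (Set.Iic (-(3*q)))ᶜ := by simp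
    rw [h3, prob_compl_eq_one_sub measurableSet_Iic]
    have h4 := gauss_tail v₀ hv₀ v hv (3*q) (by positivity)
    rw [← hε] at h4
    calc _ ≤ 1 - ENNReal.ofReal ε := tsub_le_tsub_left h4 _
      _ = ENNReal.ofReal (1 - ε) := by
          rw [ENNReal.ofReal_sub _ hε0.le, ENNReal.ofReal_one]
      _ ≤ _ := by
          refine ENNReal.ofReal_le_ofReal ?_
          rw [sub_eq_add_neg (-θ), Real.exp_add, Real.exp_neg]
          rw [inv_mul_eq_div, le_div_iff₀ (Real.exp_pos _)]
          refine le_trans ?_ e16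
          have : (1 - ε) * Real.exp θ ≤ (1-ε) * (1 + θ + θ^2) := by
            apply mul_le_mul_of_nonneg_left e1; linarith
          nlinarith
  · have h1 : ∀ x, gw (θ/q) (L + x) ≤ Set.indicator (Set.Ici 0) (fun _ => ENNReal.ofReal (Real.exp (-3*θ))) x
        + Set.indicator (Set.Ici 0)ᶜ (fun _ => 1) x := by
      intro x
      by_cases hx : x ∈ Set.Ici (0:ℝ)
      · rw [Set.indicator_of_mem hx]
        refine le_trans ?_ le_self_add
        have hx0 : 0 ≤ x := hx
        unfold gw
        rw [Set.indicator_of_mem (by simp only [Set.mem_Ioi]; linarith)]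
        refine ENNReal.ofReal_le_ofReal (Real.exp_le_exp.2 ?_)
        have : θ / q * (3 * q) ≤ θ / q * (L + x) := by gcongr; linarith
        have h5 : θ / q * (3 * q) = 3 * θ := by field_simp
        linarith
      · rw [Set.indicator_of_mem (s := (Set.Ici (0:ℝ))ᶜ) hx]
        exact (gle _).trans le_add_self
    set p := (gaussianReal 0 v).real (Set.Ici 0) with hp
    have hp2 : 1/2 ≤ p := by
      have h6 := ENNReal.toReal_mono (by finiteness) (gauss_half v)
      rw [ENNReal.toReal_mul] at h6
      simp only [ENNReal.toReal_one, ENNReal.toReal_ofNat] at h6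
      rw [hp, Measure.real]; linarith
    have hp1 : p ≤ 1 := measureReal_le_one
    have hp' : (gaussianReal 0 v) (Set.Ici 0) = ENNReal.ofReal p := by
      rw [hp, ofReal_measureReal]
    refine (lintegral_mono h1).trans ?_
    rw [lintegral_add_left (by exact measurable_const.indicator measurableSet_Ici),
      lintegral_indicator_const measurableSet_Ici, lintegral_indicator_const measurableSet_Ici.compl,
      prob_compl_eq_one_sub measurableSet_Ici, hp', one_mul, ← ENNReal.ofReal_one,
      ← ENNReal.ofReal_sub _ (by linarith), ← ENNReal.ofReal_mul (Real.exp_pos _).le,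
      ← ENNReal.ofReal_add (by positivity) (by linarith)]
    refine ENNReal.ofReal_le_ofReal ?_
    have e3 : Real.exp (-3*θ) ≤ 1 := by rw [Real.exp_le_one_iff]; linarith
    have h7 : Real.exp (-3*θ) * p + (1 - p) ≤ (1 + Real.exp (-3*θ))/2 := by nlinarith
    refine h7.trans ?_
    rw [sub_eq_add_neg (-θ), Real.exp_add, Real.exp_neg θ]
    rw [inv_mul_eq_div, le_div_iff₀ (Real.exp_pos _)]
    refine le_trans ?_ e16
    have h8 : (1 + Real.exp (-3*θ))/2 * Real.exp θ = (Real.exp θ + Real.exp (-2*θ))/2 := by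
      have : Real.exp (-3*θ) * Real.exp θ = Real.exp (-2*θ) := by
        rw [← Real.exp_add]; ring_nf
      linear_combination this / 2
    rw [h8]
    have e2 : Real.exp (-2*θ) ≤ 1 - 2*θ + 4*θ^2 := by
      have := Real.abs_exp_sub_one_sub_id_le (x := -2*θ) (by rw [abs_le]; constructor <;> linarith)
      have := (abs_le.1 this).2
      nlinarith
    nlinarith

section secE
variable {ι Ω : Type*} [MeasurableSpace Ω] {τ : ι → ℝ} {ρ : Measure ℝ} {P : Measure Ω}
    {f : ι → Ω → ℝ} [IsFiniteMeasure ρ] [IsProbabilityMeasure P]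

lemma event_bound (h : GP τ ρ P f) (t : ℕ → ι) (m : ℕ) (v₀ : ℝ)
    (hv : ∀ k < m, ∀ a : ℕ → ℝ, a k = 1 →
      v₀ ≤ ∫ l, TS (Finset.range (k+1)) a (fun i => τ (t i)) l ∂ρ)
    (θ : ℝ) (hθ : 0 ≤ θ) (B : ℝ≥0∞)
    (hB : ∀ (L : ℝ) (v : ℝ≥0), v₀ ≤ v → ∫⁻ x, gw θ (L + x) ∂(gaussianReal 0 v) ≤ B) (S : ℝ) :
    P {ω | (∀ k < m, 0 < f (t k) ω) ∧ ∑ k ∈ Finset.range m, f (t k) ω ≤ S}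
      ≤ ENNReal.ofReal (Real.exp (θ * S)) * B ^ m := by
  have h1 := seq_bound h t m v₀ hv (gw θ) (gw_meas θ) B hB
  have hm : ∀ k, Measurable (f (t k)) := fun k => h.meas _
  have hms : MeasurableSet {ω | (∀ k < m, 0 < f (t k) ω) ∧ ∑ k ∈ Finset.range m, f (t k) ω ≤ S} := by
    have e : {ω | (∀ k < m, 0 < f (t k) ω) ∧ ∑ k ∈ Finset.range m, f (t k) ω ≤ S}
        = (⋂ k, ⋂ (_ : k < m), {ω | 0 < f (t k) ω}) ∩ {ω | ∑ k ∈ Finset.range m, f (t k) ω ≤ S} := by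
      ext ω; simp
    rw [e]
    apply MeasurableSet.inter
    · exact MeasurableSet.iInter fun k => MeasurableSet.iInter fun _ =>
        measurableSet_lt measurable_const (hm k)
    · exact measurableSet_le (Finset.measurable_fun_sum _ fun k _ => hm k) measurable_const
  rw [← lintegral_indicator_one hms]
  refine le_trans ?_ (mul_le_mul_right h1 _)
  rw [← lintegral_const_mul _ (Finset.measurable_fun_prod _ fun k _ =>
    (show Measurable (fun ω => gw θ (f (t k) ω)) from (gw_meas θ).comp (hm k)))]
  refine lintegral_mono fun ω => ?_
  by_cases hω : ω ∈ {ω | (∀ k < m, 0 < f (t k) ω) ∧ ∑ k ∈ Finset.range m, f (t k) ω ≤ S}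
  · rw [Set.indicator_of_mem hω]
    have h2 : ∏ k ∈ Finset.range m, gw θ (f (t k) ω)
        = ENNReal.ofReal (Real.exp (- θ * ∑ k ∈ Finset.range m, f (t k) ω)) := by
      rw [Finset.mul_sum, Real.exp_sum, ENNReal.ofReal_prod_of_nonneg (fun _ _ => (Real.exp_pos _).le)]
      refine Finset.prod_congr rfl fun k hk => ?_
      unfold gw
      rw [Set.indicator_of_mem (show f (t k) ω ∈ Set.Ioi 0 from hω.1 k (Finset.mem_range.1 hk))]
    simp only [Pi.one_apply]
    rw [h2, ← ENNReal.ofReal_mul (Real.exp_pos _).le, ← Real.exp_add, ← ENNReal.ofReal_one]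
    apply ENNReal.ofReal_le_ofReal
    apply Real.one_le_exp
    nlinarith [hω.2]
  · rw [Set.indicator_of_notMem hω]; exact zero_le

lemma TS_shift {κ : Type*} (s : Finset κ) (a t : κ → ℝ) (b : ℝ) (l : ℝ) :
    TS s a (fun i => t i + b) l = TS s a t l := by
  rw [TS_expand, TS_expand]; simp

lemma coset_bound (h : GP τ ρ P f) (s : ℝ) (hs : 0 < s) (E : Set ℝ)
    (hsub : E ⊆ Set.Icc (-(π / s)) (π / s)) (hE : 0 < volume.real E) (ν : ℝ) (hν : 0 < ν)
    (hρ : (ENNReal.ofReal ν) • volume.restrict E ≤ ρ) (n : ℕ) (hn : 0 < n) (m : ℕ)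
    (hm : (2 * π / s) * m ≤ (volume.real E / 2) * n) (u : Fin n → ι) (b : ℝ)
    (hu : ∀ i, τ (u i) = s * (i : ℝ) + b)
    (θ : ℝ) (hθ : 0 ≤ θ) (B : ℝ≥0∞)
    (hB : ∀ (L : ℝ) (v : ℝ≥0), ν * (volume.real E / 2) ≤ v →
      ∫⁻ x, gw θ (L + x) ∂(gaussianReal 0 v) ≤ B) (S : ℝ) :
    P {ω | (∀ k, 0 < f (u k) ω) ∧ ∑ k, f (u k) ω ≤ S}
      ≤ ENNReal.ofReal (Real.exp (θ * S)) * B ^ m := by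
  classical
  obtain ⟨σ, hσ⟩ := greedy_seq s hs E hsub n hn m hm
  have hinj : Set.InjOn σ (Finset.range m) := by
    have key : ∀ j k, j < k → k < m → σ j ≠ σ k := by
      intro j k hjk hk he
      have := hσ k hk (fun i => if i = k then 1 else if i = j then -1 else 0) (by simp)
      have h0 : ∀ l, TS (Finset.range (k+1)) (fun i => if i = k then 1 else if i = j then -1 else 0)
          (fun i => s * (σ i : ℝ)) l = 0 := by
        intro l
        unfold TS
        have aux : ∀ F : Fin n → ℝ, ∑ i ∈ Finset.range (k+1),
            (if i = k then (1:ℝ) else if i = j then -1 else 0) * F (σ i) = 0 := by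
          intro F
          rw [Finset.sum_eq_add_of_mem k j (by simp) (by simp; omega) (by omega)]
          · simp [he, hjk.ne]
          · intro c _ hc; simp [hc.1, hc.2]
        rw [aux (fun i => Real.cos (l * (s * (i:ℝ)))), aux (fun i => Real.sin (l * (s * (i:ℝ))))]
        simp
      simp only [h0, integral_zero] at this
      linarith
    intro j hj k hk he
    simp only [Finset.coe_range, Set.mem_Iio] at hj hk
    rcases lt_trichotomy j k with h1 | h1 | h1
    · exact (key j k h1 hk he).elim
    · exact h1
    · exact (key k j h1 hj he.symm).elim
  have hEf : IsFiniteMeasure (volume.restrict E) := by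
    refine ⟨?_⟩
    rw [Measure.restrict_apply_univ]
    exact (measure_mono hsub).trans_lt (by simp)
  have h1 := event_bound h (fun k => u (σ k)) m (ν * (volume.real E / 2)) ?_ θ hθ B hB S
  · refine (measure_mono ?_).trans h1
    rintro ω ⟨h2, h3⟩
    refine ⟨fun k _ => h2 _, le_trans ?_ h3⟩
    rw [← Finset.sum_image (f := fun i => f (u i) ω) (g := σ) hinj]
    exact Finset.sum_le_sum_of_subset_of_nonneg (Finset.subset_univ _) fun i _ _ => (h2 i).le
  · intro k hk a ha
    have h2 := hσ k hk a ha
    calc ν * (volume.real E / 2) ≤ ν * ∫ l in E, TS (Finset.range (k+1)) a (fun i => s * (σ i : ℝ)) l := by gcongr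
      _ = ∫ l, TS (Finset.range (k+1)) a (fun i => τ (u (σ i))) l ∂((ENNReal.ofReal ν) • volume.restrict E) := by
        rw [integral_smul_measure, ENNReal.toReal_ofReal hν.le, smul_eq_mul]
        congr 1
        refine integral_congr_ae (Filter.Eventually.of_forall fun l => ?_)
        simp only [hu]
        rw [TS_shift]
      _ ≤ _ := by
        refine integral_mono_measure hρ ?_ (TS_int _ _ _ _)
        exact Filter.Eventually.of_forall fun l => TS_nonneg _ _ _ _
end secE

lemma dir_mul (M : ℕ) (x : ℝ) :
    4 * Real.sin (x/2) ^ 2 * TS (Finset.range M) (fun _ => 1) (fun i => (i:ℝ)) x ≤ 4 := by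
  have h1 : ∀ M : ℕ, 2 * Real.sin (x/2) * ∑ i ∈ Finset.range M, Real.cos (x * i)
      = Real.sin ((M:ℝ) * x - x/2) + Real.sin (x/2) := by
    intro M
    induction M with
    | zero => simp [Real.sin_neg]
    | succ k ih =>
      rw [Finset.sum_range_succ, mul_add, ih]
      push_cast
      rw [show ((k:ℝ)+1) * x - x/2 = x * k + x/2 by ring, show (k:ℝ) * x - x/2 = x * k - x/2 by ring,
        Real.sin_add, Real.sin_sub]
      ring
  have h2 : ∀ M : ℕ, 2 * Real.sin (x/2) * ∑ i ∈ Finset.range M, Real.sin (x * i)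
      = - Real.cos ((M:ℝ) * x - x/2) + Real.cos (x/2) := by
    intro M
    induction M with
    | zero => simp [Real.cos_neg]
    | succ k ih =>
      rw [Finset.sum_range_succ, mul_add, ih]
      push_cast
      rw [show ((k:ℝ)+1) * x - x/2 = x * k + x/2 by ring, show (k:ℝ) * x - x/2 = x * k - x/2 by ring,
        Real.cos_add, Real.cos_sub]
      ring
  unfold TS
  simp only [one_mul]
  have e1 := h1 M
  have e2 := h2 M
  set a := (M:ℝ) * x - x/2
  have hc := Real.neg_one_le_cos (a + x/2)
  rw [Real.cos_add] at hc
  have s1 := Real.sin_sq_add_cos_sq a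
  have s2 := Real.sin_sq_add_cos_sq (x/2)
  calc _ = (2 * Real.sin (x/2) * ∑ i ∈ Finset.range M, Real.cos (x * i))^2
      + (2 * Real.sin (x/2) * ∑ i ∈ Finset.range M, Real.sin (x * i))^2 := by ring
    _ ≤ 4 := by rw [e1, e2]; nlinarith

lemma dir_le (M : ℕ) (x : ℝ) (hx : |x| ≤ π) :
    x ^ 2 * TS (Finset.range M) (fun _ => 1) (fun i => (i:ℝ)) x ≤ π ^ 2 := by
  have h1 := dir_mul M x
  have h2 : (|x| / π) ^ 2 ≤ Real.sin (x/2) ^ 2 := by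
    have h3 := Real.mul_le_sin (x := |x|/2) (by positivity) (by linarith)
    have h4 : Real.sin (|x|/2) ^ 2 = Real.sin (x/2) ^ 2 := by
      rcases abs_cases x with h | h
      · rw [h.1]
      · rw [h.1, neg_div, Real.sin_neg]; ring
    rw [← h4]
    have h5 : 2 / π * (|x|/2) = |x|/π := by field_simp
    rw [h5] at h3
    gcongr
  have h0 := TS_nonneg (Finset.range M) (fun _ => 1) (fun i => (i:ℝ)) x
  have h6 : (|x| / π) ^ 2 * TS (Finset.range M) (fun _ => 1) (fun i => (i:ℝ)) x ≤ 1 := by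
    nlinarith
  rw [div_pow, sq_abs, div_mul_eq_mul_div, div_le_one (by positivity)] at h6
  exact h6

lemma dir_le' (M : ℕ) (x : ℝ) :
    TS (Finset.range M) (fun _ => 1) (fun i => (i:ℝ)) x ≤ (M:ℝ)^2 := by
  rw [TS_expand]
  calc _ ≤ ∑ i ∈ Finset.range M, ∑ j ∈ Finset.range M, (1:ℝ) := by
        gcongr with i hi j hj
        simpa using Real.cos_le_one _
    _ = _ := by simp; ring

lemma dir_pt (M : ℕ) (hM : 0 < M) (h : ℝ) (hh : 0 < h) (γ : ℝ) (h0 : 0 ≤ γ) (h2 : γ ≤ 2) (l : ℝ) :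
    ENNReal.ofReal (TS (Finset.range M) (fun _ => 1) (fun i => (i:ℝ)) (h * l) / (M:ℝ)^2)
      ≤ ENNReal.ofReal (π / (M * h)) ^ γ * ENNReal.ofReal |l| ^ (-γ)
        + Set.indicator {l | π / h < |l|} 1 l := by
  have hM' : (0:ℝ) < M := by exact_mod_cast hM
  set T := TS (Finset.range M) (fun _ => 1) (fun i => (i:ℝ)) (h * l) with hT
  have hT1 : T / (M:ℝ)^2 ≤ 1 := by
    rw [div_le_one (by positivity)]; exact dir_le' M _
  have hT0 : 0 ≤ T := TS_nonneg _ _ _ _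
  by_cases hl : π / h < |l|
  · rw [Set.indicator_of_mem (show l ∈ {l | π / h < |l|} from hl)]
    refine le_trans ?_ le_add_self
    simpa using hT1
  refine le_trans ?_ le_self_add
  push Not at hl
  rcases eq_or_ne l 0 with rfl | hl0
  · rcases h0.eq_or_lt with rfl | hγ
    · simpa using hT1
    · simp only [abs_zero, ENNReal.ofReal_zero]
      rw [ENNReal.zero_rpow_of_neg (by linarith), ENNReal.mul_top]
      · exact le_top
      · have : 0 < ENNReal.ofReal (π / (M * h)) := by
          rw [ENNReal.ofReal_pos]; positivity
        exact (ENNReal.rpow_pos this ENNReal.ofReal_ne_top).ne'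
  · have hlp : 0 < |l| := abs_pos.2 hl0
    rw [ENNReal.ofReal_rpow_of_pos (by positivity), ENNReal.ofReal_rpow_of_pos hlp,
      ← ENNReal.ofReal_mul (by positivity)]
    apply ENNReal.ofReal_le_ofReal
    rw [Real.rpow_neg hlp.le, ← div_eq_mul_inv, ← Real.div_rpow (by positivity) hlp.le]
    set y := π / (M * h) / |l| with hy
    have hy0 : 0 < y := by positivity
    rcases le_total 1 y with h1 | h1
    · exact hT1.trans (Real.one_le_rpow h1 h0)
    · have : T / (M:ℝ)^2 ≤ y ^ (2:ℝ) := by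
        have h3 := dir_le M (h * l) (by
          rw [abs_mul, abs_of_pos hh]
          rw [le_div_iff₀ hh] at hl
          linarith)
        rw [← hT] at h3
        rw [Real.rpow_two, hy, div_div, div_pow, mul_pow, sq_abs, div_le_div_iff₀ (by positivity) (by positivity)]
        nlinarith [sq_nonneg (M:ℝ)]
      exact this.trans (Real.rpow_le_rpow_of_exponent_ge hy0 h1 h2)

lemma var_bound (ρ : Measure ℝ) [IsFiniteMeasure ρ] (M : ℕ) (hM : 0 < M) (h : ℝ) (hh : 0 < h)
    (γ : ℝ) (h0 : 0 ≤ γ) (h2 : γ ≤ 2) :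
    ENNReal.ofReal (∫ l, TS (Finset.range M) (fun _ => 1) (fun i => h * (i:ℝ)) l / (M:ℝ)^2 ∂ρ)
      ≤ ENNReal.ofReal (π / (M * h)) ^ γ * specMom ρ (-γ) + ρ {l | π / h < |l|} := by
  rw [ofReal_integral_eq_lintegral_ofReal ((TS_int _ _ _ _).div_const _)
    (Filter.Eventually.of_forall fun l => div_nonneg (TS_nonneg _ _ _ _) (by positivity))]
  have hms : MeasurableSet {l : ℝ | π / h < |l|} :=
    measurableSet_lt measurable_const measurable_id.abs
  calc _ ≤ ∫⁻ l, ENNReal.ofReal (π / (M * h)) ^ γ * ENNReal.ofReal |l| ^ (-γ)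
        + Set.indicator {l | π / h < |l|} 1 l ∂ρ := by
        refine lintegral_mono fun l => ?_
        refine le_trans (le_of_eq ?_) (dir_pt M hM h hh γ h0 h2 l)
        congr 2
        unfold TS
        congr 2 <;> refine Finset.sum_congr rfl fun i _ => ?_ <;> ring_nf
    _ = _ := by
        rw [lintegral_add_right _ (measurable_one.indicator hms), lintegral_indicator_one hms,
          lintegral_const_mul _ (by fun_prop)]
        rfl

lemma tail_mom (ρ : Measure ℝ) (δ : ℝ) (hδ : 0 < δ) (h : ℝ) (hh : 0 < h) :
    ρ {l | π / h < |l|} ≤ ENNReal.ofReal (h / π) ^ δ * specMom ρ δ := by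
  have hms : MeasurableSet {l : ℝ | π / h < |l|} :=
    measurableSet_lt measurable_const measurable_id.abs
  unfold specMom
  rw [← lintegral_indicator_one hms, ← lintegral_const_mul _ (by fun_prop)]
  refine lintegral_mono fun l => ?_
  by_cases hl : l ∈ {l : ℝ | π / h < |l|}
  · rw [Set.indicator_of_mem hl]
    have : π / h < |l| := hl
    rw [← ENNReal.mul_rpow_of_nonneg _ _ hδ.le, ← ENNReal.ofReal_mul (by positivity)]
    apply ENNReal.one_le_rpow _ hδ
    rw [ENNReal.one_le_ofReal]
    rw [div_lt_iff₀ hh] at this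
    rw [div_mul_eq_mul_div, le_div_iff₀ pi_pos]
    linarith
  · rw [Set.indicator_of_notMem hl]; exact zero_le

lemma gauss_upper (v : ℝ≥0) (V : ℝ) (hV : 0 < V) (hv : (v:ℝ) ≤ V) (x : ℝ) (hx : 0 ≤ x) :
    (gaussianReal 0 v) (Set.Ici x) ≤ ENNReal.ofReal (Real.exp (-x^2/(2*V))) := by
  have h1 := measure_ge_le_exp_mul_mgf (μ := gaussianReal 0 v) (X := id) x (t := x / V)
    (by positivity) (integrable_exp_mul_gaussianReal _)
  have hX : HasLaw (id : ℝ → ℝ) (gaussianReal 0 v) (gaussianReal 0 v) := ⟨aemeasurable_id, by simp⟩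
  rw [mgf_gaussianReal hX.map_eq] at h1
  rw [← ENNReal.ofReal_toReal (measure_ne_top (gaussianReal 0 v) (Set.Ici x))]
  apply ENNReal.ofReal_le_ofReal
  refine h1.trans ?_
  rw [← Real.exp_add, Real.exp_le_exp]
  have : v * (x/V)^2/2 ≤ V * (x/V)^2/2 := by gcongr
  have e : V * (x/V)^2/2 = x^2/(2*V) := by field_simp
  have e2 : x / V * x = x^2/(2*V) + x^2/(2*V) := by field_simp; ring
  have e3 : -x^2/(2*V) = -(x^2/(2*V)) := by ring
  rw [e3]
  linarith

section secG
variable {ι Ω : Type*} [MeasurableSpace Ω] {τ : ι → ℝ} {ρ : Measure ℝ} {P : Measure Ω}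
    {f : ι → Ω → ℝ} [IsFiniteMeasure ρ] [IsProbabilityMeasure P]

lemma union_bound (h : GP τ ρ P f) (s : ℝ) (hs : 0 < s) (E : Set ℝ)
    (hsub : E ⊆ Set.Icc (-(π / s)) (π / s)) (hE : 0 < volume.real E) (ν : ℝ) (hν : 0 < ν)
    (hρ : (ENNReal.ofReal ν) • volume.restrict E ≤ ρ) (n : ℕ) (hn : 0 < n) (m : ℕ)
    (hm : (2 * π / s) * m ≤ (volume.real E / 2) * n) (K : ℕ) (hK : 0 < K)
    (u : Fin n → Fin K → ι)
    (hu : ∀ i j, τ (u i j) = s * (i : ℝ) + s / K * ((j:ℝ) + 1))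
    (V : ℝ) (hV0 : 0 < V)
    (hV : ∫ l, TS (Finset.range (n*K)) (fun _ => 1) (fun i => s/K * (i:ℝ)) l / ((n*K : ℕ):ℝ)^2 ∂ρ ≤ V)
    (x : ℝ) (hx : 0 < x)
    (θ : ℝ) (hθ : 0 ≤ θ) (B : ℝ≥0∞)
    (hB : ∀ (L : ℝ) (v : ℝ≥0), ν * (volume.real E / 2) ≤ v →
      ∫⁻ x, gw θ (L + x) ∂(gaussianReal 0 v) ≤ B) :
    P {ω | ∀ i j, 0 < f (u i j) ω}
      ≤ ENNReal.ofReal (Real.exp (-x^2/(2*V)))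
        + K * (ENNReal.ofReal (Real.exp (θ * (n * x))) * B ^ m) := by
  classical
  have hn' : (0:ℝ) < n := by exact_mod_cast hn
  have hK' : (0:ℝ) < K := by exact_mod_cast hK
  set X : Ω → ℝ := fun ω => ∑ p : Fin n × Fin K, (1/((n*K : ℕ):ℝ)) * f (u p.1 p.2) ω with hX
  have hXm : Measurable X := Finset.measurable_fun_sum _ fun p _ => (h.meas _).const_mul _
  have hlaw := h.law' (Finset.univ : Finset (Fin n × Fin K)) (fun p => u p.1 p.2)
    (fun _ => (1/((n*K : ℕ):ℝ)))
  have hts : ∀ l, TS (Finset.univ : Finset (Fin n × Fin K)) (fun _ => (1/((n*K : ℕ):ℝ)))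
      (fun p => τ (u p.1 p.2)) l
      = TS (Finset.range (n*K)) (fun _ => 1) (fun i => s/K * (i:ℝ)) l / ((n*K : ℕ):ℝ)^2 := by
    intro l
    have e1 : (fun p : Fin n × Fin K => τ (u p.1 p.2))
        = fun p => s/K * ((finProdFinEquiv p : Fin (n*K)) : ℝ) + s / K := by
      ext p
      rw [hu, finProdFinEquiv_apply_val]
      push_cast
      field_simp
      ring
    rw [e1, TS_shift]
    have aux : ∀ F : ℕ → ℝ, ∑ p : Fin n × Fin K, (1/((n*K : ℕ):ℝ)) * F (finProdFinEquiv p)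
        = (1/((n*K : ℕ):ℝ)) * ∑ i ∈ Finset.range (n*K), 1 * F i := by
      intro F
      rw [← Finset.mul_sum]
      congr 1
      rw [Equiv.sum_comp finProdFinEquiv (fun i : Fin (n*K) => F i), Finset.sum_range]
      simp
    unfold TS
    rw [aux (fun i => Real.cos (l * (s/K * (i:ℝ)))), aux (fun i => Real.sin (l * (s/K * (i:ℝ))))]
    field_simp
  have hA : P {ω | x ≤ X ω} ≤ ENNReal.ofReal (Real.exp (-x^2/(2*V))) := by
    have : P {ω | x ≤ X ω} = (P.map X) (Set.Ici x) := by
      rw [Measure.map_apply hXm measurableSet_Ici]; rfl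
    rw [this, hX, hlaw]
    apply gauss_upper _ _ hV0 _ _ hx.le
    rw [Real.coe_toNNReal']
    simp only [hts]
    exact max_le hV hV0.le
  have hco : ∀ j : Fin K, P {ω | (∀ i, 0 < f (u i j) ω) ∧ ∑ i, f (u i j) ω ≤ n * x}
      ≤ ENNReal.ofReal (Real.exp (θ * (n * x))) * B ^ m := fun j =>
    coset_bound h s hs E hsub hE ν hν hρ n hn m hm (fun i => u i j) (s / K * ((j:ℝ)+1))
      (fun i => hu i j) θ hθ B hB _
  have hcover : {ω | ∀ i j, 0 < f (u i j) ω} ⊆ {ω | x ≤ X ω} ∪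
      ⋃ j : Fin K, {ω | (∀ i, 0 < f (u i j) ω) ∧ ∑ i, f (u i j) ω ≤ n * x} := by
    intro ω hω
    by_cases hx1 : x ≤ X ω
    · exact Or.inl hx1
    right
    push Not at hx1
    simp only [Set.mem_iUnion]
    by_contra hcon
    push Not at hcon
    have h1 : ∀ j : Fin K, n * x < ∑ i, f (u i j) ω := by
      intro j
      by_contra h2
      exact hcon j ⟨fun i => hω i j, not_lt.1 h2⟩
    have h2 : ∑ j : Fin K, (n * x) ≤ ∑ j : Fin K, ∑ i, f (u i j) ω :=
      Finset.sum_le_sum fun j _ => (h1 j).le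
    have h3 : X ω = (∑ j : Fin K, ∑ i, f (u i j) ω) / ((n*K : ℕ):ℝ) := by
      rw [hX]; simp only
      rw [← Finset.mul_sum, Fintype.sum_prod_type, Finset.sum_comm]
      ring
    rw [h3, div_lt_iff₀ (by push_cast; positivity)] at hx1
    simp at h2 hx1
    linarith
  calc _ ≤ P {ω | x ≤ X ω} + P (⋃ j : Fin K, {ω | (∀ i, 0 < f (u i j) ω) ∧ ∑ i, f (u i j) ω ≤ n * x}) :=
        (measure_mono hcover).trans (measure_union_le _ _)
    _ ≤ _ := by
        refine add_le_add hA ((measure_iUnion_fintype_le _ _).trans ?_)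
        refine (Finset.sum_le_sum fun j _ => hco j).trans ?_
        simp
end secG

/-- the abstract two-term bound -/
def AB (S : ℕ → ℝ → Prop) (V v₀ β A γ : ℝ) : Prop :=
  ∀ (n : ℕ) (p : ℝ), 0 < n → S n p → 0 < p ∧ ∀ (m : ℕ), (m:ℝ) ≤ β * n → ∀ x θ b : ℝ, 0 < x → 0 ≤ θ →
    (∀ (L : ℝ) (v : ℝ≥0), v₀ ≤ v → ∫⁻ x, gw θ (L + x) ∂(gaussianReal 0 v) ≤ ENNReal.ofReal (Real.exp b)) →
    p ≤ Real.exp (-(x^2 * (n:ℝ)^γ/(2*V))) + 2 * (n:ℝ)^A * (Real.exp (θ * (n * x)) * Real.exp b ^ m)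

lemma AB.use {S : ℕ → ℝ → Prop} {V v₀ β A γ : ℝ} (h : AB S V v₀ β A γ) (n : ℕ) (p : ℝ) (hn : 0 < n)
    (hS : S n p) (m : ℕ) (hm : (m:ℝ) ≤ β * n) (x θ b : ℝ) (hx : 0 < x) (hθ : 0 ≤ θ)
    (hB : ∀ (L : ℝ) (v : ℝ≥0), v₀ ≤ v → ∫⁻ x, gw θ (L + x) ∂(gaussianReal 0 v) ≤ ENNReal.ofReal (Real.exp b))
    (Φ : ℝ) (h1 : 2 * Φ ≤ x^2 * (n:ℝ)^γ/(2*V))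
    (h2 : Real.log 2 + A * Real.log n + θ * (n * x) + b * m ≤ - (2 * Φ)) (h3 : Real.log 2 ≤ Φ) :
    Real.log p ≤ - Φ := by
  obtain ⟨hp, h4⟩ := h n p hn hS
  have h5 := h4 m hm x θ b hx hθ hB
  have hn' : (0:ℝ) < n := by exact_mod_cast hn
  rw [Real.log_le_iff_le_exp hp]
  have e1 : 2 * (n:ℝ)^A * (Real.exp (θ * (n * x)) * Real.exp b ^ m)
      = Real.exp (Real.log 2 + A * Real.log n + θ * (n * x) + b * m) := by
    rw [Real.exp_add, Real.exp_add, Real.exp_add, Real.exp_log (by norm_num), Real.rpow_def_of_pos hn',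
      ← Real.exp_nat_mul, mul_comm A, mul_comm (m:ℝ) b]
    ring
  rw [e1] at h5
  have e2 : Real.exp (-(x^2 * (n:ℝ)^γ/(2*V))) ≤ Real.exp (-(2 * Φ)) := Real.exp_le_exp.2 (by linarith)
  have e3 := Real.exp_le_exp.2 h2
  have e4 : Real.exp (-(2*Φ)) ≤ Real.exp (-Φ) * (1/2) := by
    have : Real.exp (-Real.log 2) = 1/2 := by rw [Real.exp_neg, Real.exp_log (by norm_num)]; norm_num
    rw [← this, ← Real.exp_add, Real.exp_le_exp]; linarith
  linarith

lemma log_ev (c r : ℝ) (hc : 0 < c) (hr : 0 < r) : ∀ᶠ n : ℕ in Filter.atTop, Real.log n ≤ c * (n:ℝ)^r := by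
  have h1 := (isLittleO_log_rpow_atTop hr).bound hc
  have h2 := tendsto_natCast_atTop_atTop (R := ℝ) |>.eventually h1
  filter_upwards [h2] with n hn
  refine (le_abs_self _).trans (hn.trans (le_of_eq ?_))
  rw [Real.norm_of_nonneg (by positivity)]

lemma log_ge_ev (c : ℝ) : ∀ᶠ n : ℕ in Filter.atTop, c ≤ Real.log n :=
  (Real.tendsto_log_atTop.comp (tendsto_natCast_atTop_atTop (R := ℝ))).eventually_ge_atTop c

lemma nat_ge_ev (c : ℝ) : ∀ᶠ n : ℕ in Filter.atTop, c ≤ (n:ℝ) :=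
  (tendsto_natCast_atTop_atTop (R := ℝ)).eventually_ge_atTop c

lemma asym_eq {S : ℕ → ℝ → Prop} {V v₀ β A : ℝ} (hV : 0 < V) (hv₀ : 0 < v₀) (hβ : 0 < β) (hA : 0 ≤ A)
    (h : AB S V v₀ β A 1) :
    ∃ c : ℝ, 0 < c ∧ ∀ᶠ n : ℕ in Filter.atTop, ∀ p, S n p → Real.log p ≤ - (c * n) := by
  set D := 3 / β with hD
  have hD0 : 0 < D := by positivity
  set x := √v₀ * Real.exp (-D) with hx
  have hs : 0 < √v₀ := Real.sqrt_pos.2 hv₀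
  have hx0 : 0 < x := by positivity
  refine ⟨min (x^2/(4*V)) (1/2), by positivity, ?_⟩
  set c := min (x^2/(4*V)) (1/2) with hc
  have hc0 : 0 < c := by positivity
  have hc1 : c ≤ x^2/(4*V) := min_le_left _ _
  have hc2 : c ≤ 1/2 := min_le_right _ _
  filter_upwards [log_ev (1/(2*(A+1))) 1 (by positivity) one_pos, nat_ge_ev (2*(Real.log 2 + D)),
    nat_ge_ev (Real.log 2 / c), Filter.eventually_gt_atTop 0] with n h1 h2 h3 h4 p hS
  have hn' : (0:ℝ) < n := by exact_mod_cast h4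
  refine h.use n p h4 hS ⌊β * n⌋₊ (Nat.floor_le (by positivity)) x (1/x) (-D) hx0 (by positivity) ?_ _ ?_ ?_ ?_
  · intro L v hv
    refine (gauss_bound_one v₀ hv₀ (1/x) (by positivity) L v hv).trans (le_of_eq ?_)
    congr 1
    rw [hx]; field_simp
  · rw [Real.rpow_one]
    have : c * n ≤ x^2/(4*V) * n := by gcongr
    have e : x^2 * n/(2*V) = 2 * (x^2/(4*V) * n) := by field_simp; norm_num
    rw [e]; linarith
  · have e1 : 1/x * (n * x) = n := by field_simp
    have e2 : β * n - 1 ≤ (⌊β * n⌋₊:ℝ) := (Nat.sub_one_lt_floor _).le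
    have e3 : D * (β * n - 1) ≤ D * (⌊β * n⌋₊:ℝ) := by gcongr
    have e4 : D * (β * n - 1) = 3 * n - D := by rw [hD]; field_simp
    have e5 : A * Real.log n ≤ n/2 := by
      rw [Real.rpow_one] at h1
      calc A * Real.log n ≤ A * (1/(2*(A+1)) * n) := by gcongr
        _ ≤ (A+1) * (1/(2*(A+1)) * n) := by gcongr; linarith
        _ = n/2 := by field_simp
    rw [e1]
    have : c * n ≤ 1/2 * n := by gcongr
    linarith
  · rw [div_le_iff₀ hc0] at h3; linarith

lemma asym_gt {S : ℕ → ℝ → Prop} {V v₀ β A γ : ℝ} (hV : 0 < V) (hv₀ : 0 < v₀) (hβ : 0 < β) (hA : 0 ≤ A)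
    (hγ : 1 < γ) (h : AB S V v₀ β A γ) :
    ∃ c : ℝ, 0 < c ∧ ∀ᶠ n : ℕ in Filter.atTop, ∀ p, S n p → Real.log p ≤ - (c * (n * Real.log n)) := by
  set η := (γ - 1)/4 with hη
  have hη0 : 0 < η := by rw [hη]; linarith
  have hs : 0 < √v₀ := Real.sqrt_pos.2 hv₀
  set c := β * η / 16 with hc
  have hc0 : 0 < c := by positivity
  refine ⟨c, hc0, ?_⟩
  filter_upwards [log_ev (1/(4*V*c)) (2*η) (by positivity) (by positivity),
    log_ge_ev 1, log_ge_ev (-2 * Real.log (√v₀) / η), log_ge_ev ((Real.log 2 + A + 1)/(2*c)),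
    nat_ge_ev (2/β), nat_ge_ev (Real.log 2/c), nat_ge_ev 1]
    with n h1 h2 h3 h4 h5 h6 h7 p hS
  have hn' : (0:ℝ) < n := by linarith
  have hn0 : 0 < n := by exact_mod_cast hn'
  set x := (n:ℝ)^(-η) with hx
  have hx0 : 0 < x := by positivity
  refine h.use n p hn0 hS ⌊β * n⌋₊ (Nat.floor_le (by positivity)) x (1/x)
    (-(η * Real.log n) - Real.log (√v₀)) hx0 (by positivity) ?_ _ ?_ ?_ ?_
  · intro L v hv
    refine (gauss_bound_one v₀ hv₀ (1/x) (by positivity) L v hv).trans (le_of_eq ?_)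
    congr 1
    rw [Real.exp_sub, Real.exp_log hs, hx, Real.rpow_def_of_pos hn',
      show Real.log n * -η = -(η * Real.log n) by ring]
    field_simp
  · have e1 : x^2 * (n:ℝ)^γ = n * (n:ℝ)^(2*η) := by
      rw [hx, ← Real.rpow_natCast, ← Real.rpow_mul hn'.le, ← Real.rpow_add hn']
      nth_rewrite 2 [← Real.rpow_one (n:ℝ)]
      rw [← Real.rpow_add hn']
      congr 1
      rw [hη]; push_cast; ring
    rw [e1]
    calc 2 * (c * (n * Real.log n)) = 2 * c * n * Real.log n := by ring
      _ ≤ 2 * c * n * (1/(4*V*c) * (n:ℝ)^(2*η)) := by gcongr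
      _ = _ := by field_simp; norm_num
  · have e1 : 1/x * (n * x) = n := by field_simp
    rw [e1]
    have e2 : β * n - 1 ≤ (⌊β * n⌋₊:ℝ) := (Nat.sub_one_lt_floor _).le
    have e3 : β * n / 2 ≤ (⌊β * n⌋₊:ℝ) := by
      rw [div_le_iff₀ hβ] at h5; linarith
    have e4 : η / 2 * Real.log n ≤ η * Real.log n + Real.log (√v₀) := by
      rw [div_le_iff₀ hη0] at h3; linarith
    have e5 : (η / 2 * Real.log n) * (β * n / 2) ≤ (η * Real.log n + Real.log (√v₀)) * (⌊β * n⌋₊:ℝ) := by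
      have : 0 ≤ η / 2 * Real.log n := by positivity
      gcongr
      exact this.trans e4
    have e6 : (η / 2 * Real.log n) * (β * n / 2) = 4 * c * (n * Real.log n) := by rw [hc]; ring
    have e7 : Real.log 2 + A * Real.log n + n ≤ 2 * c * (n * Real.log n) := by
      rw [div_le_iff₀ (by positivity)] at h4
      have f1 : Real.log n ≤ n := (Real.log_le_self hn'.le)
      have f2 : A * Real.log n ≤ A * n := by gcongr
      have f3 : Real.log 2 ≤ Real.log 2 * n := by nlinarith [Real.log_pos one_lt_two]
      have f4 : (Real.log 2 + A + 1) * n ≤ (Real.log n * (2*c)) * n := by gcongr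
      nlinarith
    linarith
  · rw [div_le_iff₀ hc0] at h6
    have : (n:ℝ) * 1 ≤ n * Real.log n := by gcongr
    nlinarith

set_option maxHeartbeats 1000000 in
lemma asym_lt {S : ℕ → ℝ → Prop} {V v₀ β A γ : ℝ} (hV : 0 < V) (hv₀ : 0 < v₀) (hβ : 0 < β) (hA : 0 ≤ A)
    (hγ0 : 0 ≤ γ) (hγ : γ < 1) (h : AB S V v₀ β A γ) :
    ∃ c : ℝ, 0 < c ∧ ∀ᶠ n : ℕ in Filter.atTop, ∀ p, S n p →
      Real.log p ≤ - (c * ((n:ℝ)^γ * Real.log n)) := by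
  set κ := (1-γ) * β^2 * v₀ / 72 with hκ
  have hγ1 : 0 < 1 - γ := by linarith
  have hκ0 : 0 < κ := by positivity
  have hs : 0 < √v₀ := Real.sqrt_pos.2 hv₀
  set c := κ/(4*V) with hc
  have hc0 : 0 < c := by positivity
  set d := Real.exp (-1) * β / 96 with hd
  have hd0 : 0 < d := by positivity
  refine ⟨c, hc0, ?_⟩
  filter_upwards [log_ev (d/(2*c+A+1)) ((1-γ)/2) (by positivity) (by positivity),
    log_ge_ev 1, log_ge_ev (Real.log 2/c), nat_ge_ev (2/β), nat_ge_ev 1]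
    with n h1 h2 h3 h4 h5 p hS
  have hn' : (0:ℝ) < n := by linarith
  have hn0 : 0 < n := by exact_mod_cast hn'
  have hl0 : 0 < Real.log n := by linarith
  set m := ⌊β * n⌋₊ with hm
  have e2 : β * n - 1 ≤ (m:ℝ) := (Nat.sub_one_lt_floor _).le
  have e3 : β * n / 2 ≤ (m:ℝ) := by
    rw [div_le_iff₀ hβ] at h4; linarith
  have hm0 : (0:ℝ) < m := lt_of_lt_of_le (by positivity) e3
  set x := √(κ * Real.log n) with hx
  have hx0 : 0 < x := Real.sqrt_pos.2 (by positivity)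
  have hx2 : x^2 = κ * Real.log n := Real.sq_sqrt (by positivity)
  set q := x * n / m with hq
  have hq0 : 0 < q := by positivity
  set ε := Real.exp (-1 - (3 * q / √v₀) ^ 2) / 3 with hε
  have hε0 : 0 < ε := by positivity
  have hpow : (1:ℝ) ≤ (n:ℝ)^γ := Real.one_le_rpow h5 hγ0
  refine h.use n p hn0 hS m (Nat.floor_le (by positivity)) x (ε/4/q)
    (-(ε/4) - ε/16) hx0 (by positivity) ?_ _ ?_ ?_ ?_
  · intro L v hv
    exact gauss_bound_two v₀ hv₀ q hq0 ε hε L v hv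
  · rw [hx2, hc]
    apply le_of_eq
    field_simp
    ring
  · have e4 : ε / 4 / q * (n * x) = ε / 4 * m := by rw [hq]; field_simp
    rw [e4]
    have hqx : q ≤ 2 * x / β := by
      rw [hq, div_le_div_iff₀ hm0 hβ]
      nlinarith
    have e5 : (3 * q / √v₀)^2 ≤ (1-γ)/2 * Real.log n := by
      rw [div_pow, Real.sq_sqrt hv₀.le, div_le_iff₀ hv₀]
      calc (3 * q)^2 ≤ (3 * (2 * x / β))^2 := by gcongr
        _ = 36 / β^2 * x^2 := by ring
        _ = _ := by rw [hx2, hκ]; field_simp; ring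
    have e6 : Real.exp (-1) / 3 * (n:ℝ)^(-((1-γ)/2)) ≤ ε := by
      rw [hε, Real.rpow_def_of_pos hn', div_mul_eq_mul_div, ← Real.exp_add]
      gcongr
      linarith
    have e7 : d * (n:ℝ)^((1+γ)/2) ≤ ε * m / 16 := by
      calc d * (n:ℝ)^((1+γ)/2) = (Real.exp (-1) / 3 * (n:ℝ)^(-((1-γ)/2))) * (β * n / 2) / 16 := by
            rw [show (1+γ)/2 = -((1-γ)/2) + 1 by ring, Real.rpow_add hn', Real.rpow_one, hd]; ring
        _ ≤ _ := by gcongr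
    have e8 : (2*c+A+1) * ((n:ℝ)^γ * Real.log n) ≤ d * (n:ℝ)^((1+γ)/2) := by
      calc (2*c+A+1) * ((n:ℝ)^γ * Real.log n)
          ≤ (2*c+A+1) * ((n:ℝ)^γ * (d/(2*c+A+1) * (n:ℝ)^((1-γ)/2))) := by gcongr
        _ = d * ((n:ℝ)^γ * (n:ℝ)^((1-γ)/2)) := by field_simp
        _ = _ := by rw [← Real.rpow_add hn']; congr 2; ring
    have e9 : Real.log n ≤ (n:ℝ)^γ * Real.log n := by nlinarith
    have e10 : Real.log 2 ≤ 1 := by linarith [Real.log_two_lt_d9]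
    have e11 : A * Real.log n ≤ A * ((n:ℝ)^γ * Real.log n) := by gcongr
    clear_value ε m
    linarith
  · rw [div_le_iff₀ hc0] at h3
    have e9 : Real.log n ≤ (n:ℝ)^γ * Real.log n := by nlinarith
    nlinarith

lemma asym_final (p : ℝ → ℝ) (s : ℝ) (hs : 0 < s) {V v₀ β A γ : ℝ} (hV : 0 < V) (hv₀ : 0 < v₀)
    (hβ : 0 < β) (hA : 0 ≤ A) (hγ0 : 0 ≤ γ)
    (h : AB (fun n q => ∃ N : ℝ, n = ⌊N/s⌋₊ ∧ q = p N) V v₀ β A (min γ 2)) :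
    ∃ N₀ C : ℝ, 0 < N₀ ∧ 0 < C ∧
      ∀ N : ℝ, N₀ < N →
        (γ < 1 → Real.log (p N) ≤ -C * N ^ γ * Real.log N) ∧
        (γ = 1 → Real.log (p N) ≤ -C * N) ∧
        (1 < γ → Real.log (p N) ≤ -C * (γ - 1) * N * Real.log N) := by
  have htend : Filter.Tendsto (fun N : ℝ => ⌊N/s⌋₊) Filter.atTop Filter.atTop :=
    tendsto_nat_floor_atTop.comp (Filter.tendsto_id.atTop_div_const hs)
  have hev : ∀ᶠ N : ℝ in Filter.atTop, N / (2*s) ≤ (⌊N/s⌋₊:ℝ) ∧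
      Real.log N / 2 ≤ Real.log (⌊N/s⌋₊:ℝ) ∧ 0 < Real.log N ∧ 0 < N := by
    filter_upwards [Filter.eventually_ge_atTop (2*s), Filter.eventually_gt_atTop 0,
      Real.tendsto_log_atTop.eventually_ge_atTop (2 * Real.log (2*s)),
      Real.tendsto_log_atTop.eventually_gt_atTop 0] with N h1 h2 h3 h4
    have e1 : N/s - 1 ≤ (⌊N/s⌋₊:ℝ) := (Nat.sub_one_lt_floor _).le
    have e2 : N / (2*s) ≤ (⌊N/s⌋₊:ℝ) := by
      have : 1 ≤ N / (2*s) := by rw [le_div_iff₀ (by positivity)]; linarith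
      have e : N/s = 2 * (N/(2*s)) := by field_simp
      linarith
    refine ⟨e2, ?_, h4, h2⟩
    have := Real.log_le_log (by positivity) e2
    rw [Real.log_div h2.ne' (by positivity)] at this
    linarith
  suffices H : ∃ C : ℝ, 0 < C ∧ ∀ᶠ N : ℝ in Filter.atTop, 
        (γ < 1 → Real.log (p N) ≤ -C * N ^ γ * Real.log N) ∧
        (γ = 1 → Real.log (p N) ≤ -C * N) ∧
        (1 < γ → Real.log (p N) ≤ -C * (γ - 1) * N * Real.log N) by
    obtain ⟨C, hC, hN⟩ := H
    obtain ⟨N₀, hN₀⟩ := Filter.eventually_atTop.1 hN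
    exact ⟨max N₀ 1, C, by positivity, hC, fun N hN => hN₀ N ((le_max_left _ _).trans hN.le)⟩
  rcases lt_trichotomy γ 1 with hγ | hγ | hγ
  · rw [min_eq_left (by linarith)] at h
    obtain ⟨c, hc, hc2⟩ := asym_lt hV hv₀ hβ hA hγ0 hγ h
    refine ⟨c / (2 * (2*s)^γ), by positivity, ?_⟩
    filter_upwards [hev, htend.eventually hc2] with N ⟨h1, h2, h3, h4⟩ h5
    refine ⟨fun _ => ?_, fun _ => by linarith, fun _ => by linarith⟩
    refine (h5 (p N) ⟨N, rfl, rfl⟩).trans ?_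
    have : (N/(2*s))^γ * (Real.log N / 2) ≤ (⌊N/s⌋₊:ℝ)^γ * Real.log (⌊N/s⌋₊:ℝ) := by gcongr
    have e : c * ((N/(2*s))^γ * (Real.log N / 2)) = c / (2 * (2*s)^γ) * N^γ * Real.log N := by
      rw [Real.div_rpow h4.le (by positivity)]; field_simp
    nlinarith
  · subst hγ
    rw [min_eq_left (by norm_num)] at h
    obtain ⟨c, hc, hc2⟩ := asym_eq hV hv₀ hβ hA h
    refine ⟨c / (2*s), by positivity, ?_⟩
    filter_upwards [hev, htend.eventually hc2] with N ⟨h1, h2, h3, h4⟩ h5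
    refine ⟨fun _ => by linarith, fun _ => ?_, fun _ => by linarith⟩
    refine (h5 (p N) ⟨N, rfl, rfl⟩).trans ?_
    have e : c * (N/(2*s)) = c / (2*s) * N := by ring
    nlinarith
  · have hg : 0 < γ - 1 := by linarith
    obtain ⟨c, hc, hc2⟩ := asym_gt hV hv₀ hβ hA (lt_min hγ (by norm_num)) h
    refine ⟨c / (4*s) / (γ - 1), by positivity, ?_⟩
    filter_upwards [hev, htend.eventually hc2] with N ⟨h1, h2, h3, h4⟩ h5
    refine ⟨fun _ => by linarith, fun _ => by linarith, fun _ => ?_⟩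
    refine (h5 (p N) ⟨N, rfl, rfl⟩).trans ?_
    have : (N/(2*s)) * (Real.log N / 2) ≤ (⌊N/s⌋₊:ℝ) * Real.log (⌊N/s⌋₊:ℝ) := by gcongr
    have e : c * ((N/(2*s)) * (Real.log N / 2)) = c / (4*s) / (γ-1) * (γ-1) * N * Real.log N := by
      field_simp; norm_num
    nlinarith

section secJ
variable {N : ℝ}

lemma mgf_ne_zero_ae (μ : Measure (Set.Icc (0:ℝ) N)) [IsProbabilityMeasure μ] :
    ∀ᵐ l : ℝ, complexMGF (fun x : Set.Icc (0:ℝ) N => (x:ℝ)) μ (l * Complex.I) ≠ 0 := by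
  have huniv : integrableExpSet (fun x : Set.Icc (0:ℝ) N => (x:ℝ)) μ = Set.univ := by
    ext t
    simp only [integrableExpSet, Set.mem_ofPred_eq, Set.mem_univ, iff_true]
    have : Continuous (fun x : Set.Icc (0:ℝ) N => Real.exp (t * x)) := by fun_prop
    exact this.integrable_of_hasCompactSupport (HasCompactSupport.of_compactSpace _)
  have han : AnalyticOnNhd ℝ (fun l : ℝ =>
      complexMGF (fun x : Set.Icc (0:ℝ) N => (x:ℝ)) μ (l * Complex.I)) Set.univ := by
    intro l _
    have h1 : AnalyticAt ℂ (complexMGF (fun x : Set.Icc (0:ℝ) N => (x:ℝ)) μ) (l * Complex.I) :=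
      analyticAt_complexMGF (by simp [huniv])
    have h2 : AnalyticAt ℝ (fun l : ℝ => (l:ℂ) * Complex.I) l :=
      (Complex.ofRealCLM.analyticAt l).mul analyticAt_const
    exact AnalyticAt.fun_comp (g := complexMGF (fun x : Set.Icc (0:ℝ) N => (x:ℝ)) μ)
      (f := fun l : ℝ => (l:ℂ) * Complex.I) (h1.restrictScalars (𝕜 := ℝ)) h2
  rcases han.eqOn_zero_or_eventually_ne_zero_of_preconnected isPreconnected_univ with h | h
  · have := h (Set.mem_univ 0)
    simp [complexMGF] at this
  · have h2 := ae_restrict_le_codiscreteWithin (μ := (volume : Measure ℝ)) MeasurableSet.univ h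
    rw [Measure.restrict_univ] at h2
    exact h2

/-- cosine transform -/
def cT (μ : Measure (Set.Icc (0:ℝ) N)) (l : ℝ) : ℝ := ∫ x, Real.cos (l * (x:ℝ)) ∂μ
/-- sine transform -/
def sT (μ : Measure (Set.Icc (0:ℝ) N)) (l : ℝ) : ℝ := ∫ x, Real.sin (l * (x:ℝ)) ∂μ

lemma cT_cont_l (μ : Measure (Set.Icc (0:ℝ) N)) [IsProbabilityMeasure μ] : Continuous (cT μ) := by
  unfold cT
  refine continuous_of_dominated (bound := fun _ => 1) ?_ ?_ (integrable_const _) ?_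
  · intro l
    exact (by fun_prop : Continuous fun x : Set.Icc (0:ℝ) N => Real.cos (l * (x:ℝ))).aestronglyMeasurable
  · intro l; exact Filter.Eventually.of_forall fun x => Real.abs_cos_le_one _
  · exact Filter.Eventually.of_forall fun x => by fun_prop

lemma sT_cont_l (μ : Measure (Set.Icc (0:ℝ) N)) [IsProbabilityMeasure μ] : Continuous (sT μ) := by
  unfold sT
  refine continuous_of_dominated (bound := fun _ => 1) ?_ ?_ (integrable_const _) ?_
  · intro l
    exact (by fun_prop : Continuous fun x : Set.Icc (0:ℝ) N => Real.sin (l * (x:ℝ))).aestronglyMeasurable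
  · intro l; exact Filter.Eventually.of_forall fun x => Real.abs_sin_le_one _
  · exact Filter.Eventually.of_forall fun x => by fun_prop

lemma cT_cont_m (l : ℝ) : Continuous (fun μ : ProbabilityMeasure (Set.Icc (0:ℝ) N) => cT (μ : Measure (Set.Icc (0:ℝ) N)) l) :=
  ProbabilityMeasure.continuous_integral_boundedContinuousFunction
    (BoundedContinuousFunction.mkOfCompact ⟨fun x : Set.Icc (0:ℝ) N => Real.cos (l * (x:ℝ)), by fun_prop⟩)

lemma sT_cont_m (l : ℝ) : Continuous (fun μ : ProbabilityMeasure (Set.Icc (0:ℝ) N) => sT (μ : Measure (Set.Icc (0:ℝ) N)) l) :=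
  ProbabilityMeasure.continuous_integral_boundedContinuousFunction
    (BoundedContinuousFunction.mkOfCompact ⟨fun x : Set.Icc (0:ℝ) N => Real.sin (l * (x:ℝ)), by fun_prop⟩)

lemma cT_le (μ : Measure (Set.Icc (0:ℝ) N)) [IsProbabilityMeasure μ] (l : ℝ) : |cT μ l| ≤ 1 := by
  have := norm_integral_le_of_norm_le_const (μ := μ) (f := fun x => Real.cos (l * (x:ℝ))) (C := 1)
    (Filter.Eventually.of_forall fun x => Real.abs_cos_le_one _)
  simpa [cT, sT] using this

lemma sT_le (μ : Measure (Set.Icc (0:ℝ) N)) [IsProbabilityMeasure μ] (l : ℝ) : |sT μ l| ≤ 1 := by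
  have := norm_integral_le_of_norm_le_const (μ := μ) (f := fun x => Real.sin (l * (x:ℝ))) (C := 1)
    (Filter.Eventually.of_forall fun x => Real.abs_sin_le_one _)
  simpa [cT, sT] using this

lemma cs_bound (μ : Measure (Set.Icc (0:ℝ) N)) [IsProbabilityMeasure μ] (l : ℝ) :
    ‖cT μ l ^ 2 + sT μ l ^ 2‖ ≤ 2 := by
  rw [Real.norm_of_nonneg (by positivity)]
  have h1 := (sq_le_one_iff_abs_le_one (cT μ l)).2 (cT_le μ l)
  have h2 := (sq_le_one_iff_abs_le_one (sT μ l)).2 (sT_le μ l)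
  linarith

lemma cs_zero (μ : Measure (Set.Icc (0:ℝ) N)) [IsProbabilityMeasure μ] (l : ℝ)
    (h : cT μ l ^ 2 + sT μ l ^ 2 = 0) :
    complexMGF (fun x : Set.Icc (0:ℝ) N => (x:ℝ)) μ (l * Complex.I) = 0 := by
  have h1 : cT μ l = 0 := by nlinarith [sq_nonneg (cT μ l), sq_nonneg (sT μ l)]
  have h2 : sT μ l = 0 := by nlinarith [sq_nonneg (cT μ l), sq_nonneg (sT μ l)]
  unfold complexMGF
  have hc : Continuous (fun x : Set.Icc (0:ℝ) N => Complex.exp (l * Complex.I * (x:ℝ))) := by fun_prop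
  have hi : Integrable (fun x : Set.Icc (0:ℝ) N => Complex.exp (l * Complex.I * (x:ℝ))) μ :=
    hc.integrable_of_hasCompactSupport (HasCompactSupport.of_compactSpace _)
  have e : ∀ x : Set.Icc (0:ℝ) N, Complex.exp (l * Complex.I * (x:ℝ))
      = Real.cos (l * x) + Real.sin (l * x) * Complex.I := by
    intro x
    rw [show (l:ℂ) * Complex.I * (x:ℝ) = ((l * x : ℝ):ℂ) * Complex.I by push_cast; ring, Complex.exp_mul_I]
    push_cast; rfl
  apply Complex.ext
  · rw [← Complex.reCLM_apply, ← ContinuousLinearMap.integral_comp_comm _ hi]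
    rw [Complex.zero_re]
    refine Eq.trans ?_ h1
    refine integral_congr_ae (Filter.Eventually.of_forall fun x => ?_)
    simp only [e, Complex.reCLM_apply]
    simp only [Complex.add_re, Complex.ofReal_re, Complex.re_ofReal_mul, Complex.I_re, mul_zero, add_zero]
  · rw [← Complex.imCLM_apply, ← ContinuousLinearMap.integral_comp_comm _ hi]
    rw [Complex.zero_im]
    refine Eq.trans ?_ h2
    refine integral_congr_ae (Filter.Eventually.of_forall fun x => ?_)
    simp only [e, Complex.imCLM_apply]
    simp only [Complex.add_im, Complex.ofReal_im, Complex.im_ofReal_mul, Complex.I_im, mul_one, zero_add]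

lemma unif_lower (hN : 0 ≤ N) (E : Set ℝ) (hE : MeasurableSet E) (hb : volume E < ⊤) (hpos : 0 < volume E) :
    ∃ v : ℝ, 0 < v ∧ ∀ μ : ProbabilityMeasure (Set.Icc (0:ℝ) N),
      v ≤ ∫ l in E, (cT (μ : Measure (Set.Icc (0:ℝ) N)) l ^ 2 + sT (μ : Measure (Set.Icc (0:ℝ) N)) l ^ 2) := by
  have : Nonempty (Set.Icc (0:ℝ) N) := ⟨⟨0, le_rfl, hN⟩⟩
  have : Nonempty (ProbabilityMeasure (Set.Icc (0:ℝ) N)) := ⟨⟨Measure.dirac ⟨0, le_rfl, hN⟩, inferInstance⟩⟩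
  have : IsFiniteMeasure (volume.restrict E) := ⟨by rwa [Measure.restrict_apply_univ]⟩
  have hmeas : ∀ μ : ProbabilityMeasure (Set.Icc (0:ℝ) N),
      AEStronglyMeasurable (fun l => cT (μ : Measure (Set.Icc (0:ℝ) N)) l ^ 2 + sT (μ : Measure (Set.Icc (0:ℝ) N)) l ^ 2) (volume.restrict E) := by
    intro μ
    exact (((cT_cont_l _).pow 2).add ((sT_cont_l _).pow 2)).aestronglyMeasurable
  have hint : ∀ μ : ProbabilityMeasure (Set.Icc (0:ℝ) N),
      Integrable (fun l => cT (μ : Measure (Set.Icc (0:ℝ) N)) l ^ 2 + sT (μ : Measure (Set.Icc (0:ℝ) N)) l ^ 2) (volume.restrict E) := fun μ =>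
    Integrable.of_bound (hmeas μ) 2 (Filter.Eventually.of_forall fun l => cs_bound _ l)
  have hcont : Continuous (fun μ : ProbabilityMeasure (Set.Icc (0:ℝ) N) =>
      ∫ l in E, (cT (μ : Measure (Set.Icc (0:ℝ) N)) l ^ 2 + sT (μ : Measure (Set.Icc (0:ℝ) N)) l ^ 2)) := by
    refine continuous_of_dominated (bound := fun _ => 2) hmeas ?_ (integrable_const _) ?_
    · intro μ; exact Filter.Eventually.of_forall fun l => cs_bound _ l
    · exact Filter.Eventually.of_forall fun l => ((cT_cont_m l).pow 2).add ((sT_cont_m l).pow 2)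
  obtain ⟨μ₀, -, hμ₀⟩ := isCompact_univ.exists_isMinOn Set.univ_nonempty hcont.continuousOn
  refine ⟨_, ?_, fun μ => hμ₀ (Set.mem_univ μ)⟩
  have h0 : 0 ≤ ∫ l in E, (cT (μ₀ : Measure (Set.Icc (0:ℝ) N)) l ^ 2 + sT (μ₀ : Measure (Set.Icc (0:ℝ) N)) l ^ 2) :=
    integral_nonneg fun l => by positivity
  refine lt_of_le_of_ne h0 fun heq => ?_
  have h1 := (integral_eq_zero_iff_of_nonneg (fun l => by positivity) (hint μ₀)).1 heq.symm
  have h2 := ae_restrict_of_ae (s := E) (mgf_ne_zero_ae (μ₀ : Measure (Set.Icc (0:ℝ) N)))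
  have h3 : ∀ᵐ l ∂(volume.restrict E), False := by
    filter_upwards [h1, h2] with l h3 h4
    exact h4 (cs_zero _ l h3)
  rw [Filter.eventually_false_iff_eq_bot, ae_eq_bot, Measure.restrict_eq_zero] at h3
  exact hpos.ne' h3

lemma unif_lower' (hN : 0 ≤ N) (E : Set ℝ) (hE : MeasurableSet E) (hb : volume E < ⊤) (hpos : 0 < volume E) :
    ∃ v : ℝ, 0 < v ∧ ∀ (κ : Type) (s : Finset κ) (w t : κ → ℝ), (∀ i ∈ s, 0 ≤ w i) → ∑ i ∈ s, w i = 1 →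
      (∀ i, t i ∈ Set.Icc 0 N) → v ≤ ∫ l in E, TS s w t l := by
  obtain ⟨v, hv, h⟩ := unif_lower hN E hE hb hpos
  refine ⟨v, hv, fun κ s w t hw hw1 ht => ?_⟩
  set μ : Measure (Set.Icc (0:ℝ) N) := ∑ i ∈ s, ENNReal.ofReal (w i) • Measure.dirac ⟨t i, ht i⟩ with hμ
  have hp : IsProbabilityMeasure μ := by
    refine ⟨?_⟩
    rw [hμ]
    simp only [Measure.coe_finsetSum, Finset.sum_apply, Measure.smul_apply, measure_univ, smul_eq_mul, mul_one]
    rw [← ENNReal.ofReal_sum_of_nonneg hw, hw1, ENNReal.ofReal_one]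
  have hint : ∀ F : Set.Icc (0:ℝ) N → ℝ, Continuous F → ∫ x, F x ∂μ = ∑ i ∈ s, w i * F ⟨t i, ht i⟩ := by
    intro F hF
    rw [hμ, integral_finsetSum_measure]
    · refine Finset.sum_congr rfl fun i hi => ?_
      rw [integral_smul_measure, integral_dirac, ENNReal.toReal_ofReal (hw i hi), smul_eq_mul]
    · intro i _
      refine Integrable.smul_measure ?_ ENNReal.ofReal_ne_top
      exact hF.integrable_of_hasCompactSupport (HasCompactSupport.of_compactSpace _)
  refine (h ⟨μ, hp⟩).trans (le_of_eq ?_)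
  refine integral_congr_ae (Filter.Eventually.of_forall fun l => ?_)
  simp only [ProbabilityMeasure.coe_mk, cT, sT, TS]
  rw [hint _ (by fun_prop), hint _ (by fun_prop)]
end secJ

section secK
variable {ι Ω : Type} [MeasurableSpace Ω] {τ : ι → ℝ} {ρ : Measure ℝ} {P : Measure Ω}
    {f : ι → Ω → ℝ} [IsFiniteMeasure ρ] [IsProbabilityMeasure P]

lemma pos_core [Countable ι] (h : GP τ ρ P f) {κ : Type} (s : Finset κ) (u : κ → ι) (w : κ → ℝ)
    (q c M : ℝ) (hq : 0 < q) (hc : 0 < c)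
    (hqv : q = Var[fun ω => ∑ i ∈ s, w i * f (u i) ω; P])
    (hlo : ∀ i, c ≤ cov[f i, fun ω => ∑ i ∈ s, w i * f (u i) ω; P])
    (hhi : ∀ i, cov[f i, fun ω => ∑ i ∈ s, w i * f (u i) ω; P] ≤ M)
    (hbdd : ∀ᵐ ω ∂P, BddBelow (Set.range fun i => f i ω)) :
    0 < P {ω | ∀ i, 1 ≤ f i ω} := by
  classical
  set X : Ω → ℝ := fun ω => ∑ i ∈ s, w i * f (u i) ω with hX
  set H : ι → ℝ := fun i => cov[f i, X; P] with hH
  set g : ι → Ω → ℝ := fun i ω => f i ω - H i / q * X ω with hg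
  have hXm : Measurable X := Finset.measurable_fun_sum _ fun i _ => (h.meas _).const_mul _
  have hXL : MemLp X 2 P := memLp_finsetSum _ fun j _ => (h.memLp _).const_mul _
  have hgm : ∀ i, Measurable (g i) := fun i => (h.meas i).sub (hXm.const_mul _)
  have hcov : ∀ i, cov[g i, X; P] = 0 := by
    intro i
    have : g i = f i - (fun ω => H i / q * X ω) := rfl
    rw [this, covariance_sub_left (h.memLp i) (hXL.const_mul _) hXL, covariance_const_mul_left,
      covariance_self hXm.aemeasurable, ← hqv, div_mul_cancel₀ _ hq.ne']
    simp [hH]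
  have hind : IndepFun (fun ω i => g i ω) (fun ω (_ : Unit) => X ω) P := by
    refine IsGaussianProcess.indepFun_of_covariance_eq_zero
      (X := g) (Y := fun (_ : Unit) => X) ?_
      (fun i => (hgm _).aemeasurable) (fun _ => hXm.aemeasurable) (fun i _ => hcov i)
    refine IsGaussianProcess.of_isGaussianProcess h.gproc fun k => ?_
    rcases k with i | v
    · refine ⟨insert i (s.image u), ContinuousLinearMap.proj (R := ℝ) (φ := fun _ => ℝ) ⟨i, by simp⟩
        - (H i / q) • ∑ j ∈ s.attach, w j •
            ContinuousLinearMap.proj (R := ℝ) (φ := fun _ => ℝ)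
            ⟨u j, Finset.mem_insert_of_mem (Finset.mem_image_of_mem u j.2)⟩, fun ω => ?_⟩
      simp only [Sum.elim_inl, hg, hX]
      rw [ContinuousLinearMap.sub_apply, ContinuousLinearMap.smul_apply, ContinuousLinearMap.sum_apply]
      simp only [ContinuousLinearMap.smul_apply, ContinuousLinearMap.proj_apply, smul_eq_mul,
        Finset.restrict]
      rw [Finset.sum_attach s (fun j => w j * f (u j) ω)]
    · refine ⟨s.image u, ∑ j ∈ s.attach, w j •
            ContinuousLinearMap.proj (R := ℝ) (φ := fun _ => ℝ)
            ⟨u j, Finset.mem_image_of_mem u j.2⟩, fun ω => ?_⟩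
      simp only [Sum.elim_inr, hX]
      rw [ContinuousLinearMap.sum_apply]
      simp only [ContinuousLinearMap.smul_apply, ContinuousLinearMap.proj_apply, smul_eq_mul,
        Finset.restrict]
      exact (Finset.sum_attach s (fun j => w j * f (u j) ω)).symm
  have hind2 : IndepFun (fun ω i => g i ω) X P :=
    hind.comp (φ := id) (ψ := fun u : Unit → ℝ => u ()) measurable_id (measurable_pi_apply _)
  have hb : ∀ᵐ ω ∂P, ω ∈ ⋃ K : ℕ, {ω | ∀ i, -(K:ℝ) ≤ g i ω} := by
    filter_upwards [hbdd] with ω hω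
    obtain ⟨b, hb⟩ := hω
    obtain ⟨K, hK⟩ := exists_nat_ge (-b + M / q * |X ω|)
    refine Set.mem_iUnion.2 ⟨K, fun i => ?_⟩
    have h1 : b ≤ f i ω := hb ⟨i, rfl⟩
    have h2 : H i / q * X ω ≤ M / q * |X ω| := by
      have h3 : 0 ≤ H i / q := div_nonneg (hc.le.trans (hlo i)) hq.le
      calc H i / q * X ω ≤ H i / q * |X ω| := by gcongr; exact le_abs_self _
        _ ≤ _ := by gcongr; exact hhi i
    simp only [hg]
    linarith
  have hne : P (⋃ K : ℕ, {ω | ∀ i, -(K:ℝ) ≤ g i ω}) ≠ 0 := by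
    intro h0
    have h1 : ∀ᵐ ω ∂P, ω ∉ ⋃ K : ℕ, {ω | ∀ i, -(K:ℝ) ≤ g i ω} := measure_eq_zero_iff_ae_notMem.1 h0
    have h2 : ∀ᵐ ω ∂P, False := by
      filter_upwards [hb, h1] with ω a b using b a
    rw [Filter.eventually_false_iff_eq_bot, ae_eq_bot] at h2
    exact IsProbabilityMeasure.ne_zero P h2
  obtain ⟨K, hK⟩ := exists_measure_pos_of_not_measure_iUnion_null hne
  have hXp : 0 < P (X ⁻¹' Set.Ici ((K+1) * q / c)) := by
    rw [← Measure.map_apply hXm measurableSet_Ici]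
    have h1 := h.law' s u w
    rw [← h.variance_eq, ← hX, ← hqv] at h1
    rw [h1]
    have h2 := gaussianReal_absolutelyContinuous' 0 (v := q.toNNReal) (by simpa using hq)
    refine pos_iff_ne_zero.2 fun h3 => ?_
    have h4 := h2 h3
    simp at h4
  have hA : MeasurableSet {x : ι → ℝ | ∀ i, -(K:ℝ) ≤ x i} := by
    rw [Set.setOf_forall]
    exact MeasurableSet.iInter fun i => measurableSet_le measurable_const (measurable_pi_apply i)
  have := hind2.measure_inter_preimage_eq_mul _ _ hA (measurableSet_Ici (a := (K+1) * q / c))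
  refine lt_of_lt_of_le ?_ (measure_mono (s := (fun ω i => g i ω) ⁻¹' {x : ι → ℝ | ∀ i, -(K:ℝ) ≤ x i} ∩ X ⁻¹' Set.Ici ((K+1) * q / c)) ?_)
  · rw [this]
    exact ENNReal.mul_pos hK.ne' hXp.ne'
  · rintro ω ⟨h1, h2⟩ i
    have h3 : -(K:ℝ) ≤ f i ω - H i / q * X ω := h1 i
    have h4 : (K+1) * q / c ≤ X ω := h2
    have h5 : (K+1 : ℝ) ≤ H i / q * X ω := by
      calc (K+1 : ℝ) = c / q * ((K+1) * q / c) := by field_simp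
        _ ≤ H i / q * X ω := by
          have := hlo i
          gcongr
          exact div_nonneg (hc.le.trans (hlo i)) hq.le
    linarith

lemma pos_prob [Countable ι] (h : GP τ ρ P f) (N : ℝ) (hN : 0 ≤ N) (hτ : ∀ i, τ i ∈ Set.Icc 0 N)
    (E : Set ℝ) (hE : MeasurableSet E) (hEf : volume E < ⊤) (hEp : 0 < volume E)
    (ν : ℝ) (hν : 0 < ν) (hρ : (ENNReal.ofReal ν) • volume.restrict E ≤ ρ)
    (hbdd : ∀ᵐ ω ∂P, BddBelow (Set.range fun i => f i ω)) :
    0 < P {ω | ∀ i, 1 ≤ f i ω} := by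
  rcases isEmpty_or_nonempty ι with hι | ⟨⟨i₀⟩⟩
  · simp
  have hfin : IsFiniteMeasure (volume.restrict E) := ⟨by rwa [Measure.restrict_apply_univ]⟩
  obtain ⟨v, hv, hlow⟩ := unif_lower' hN E hE hEf hEp
  set S : Set ℝ := {q | ∃ (κ : Type) (s : Finset κ) (u : κ → ι) (w : κ → ℝ), (∀ i ∈ s, 0 ≤ w i) ∧
    ∑ i ∈ s, w i = 1 ∧ q = Var[fun ω => ∑ i ∈ s, w i * f (u i) ω; P]} with hS
  have hSl : ∀ q ∈ S, ν * v ≤ q := by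
    rintro q ⟨κ, s, u, w, hw, hw1, rfl⟩
    rw [h.variance_eq]
    calc ν * v ≤ ν * ∫ l in E, TS s w (fun i => τ (u i)) l := by
          gcongr; exact hlow κ s w _ hw hw1 fun i => hτ _
      _ = ∫ l, TS s w (fun i => τ (u i)) l ∂((ENNReal.ofReal ν) • volume.restrict E) := by
        rw [integral_smul_measure, ENNReal.toReal_ofReal hν.le, smul_eq_mul]
      _ ≤ _ := by
        refine integral_mono_measure hρ ?_ (TS_int _ _ _ _)
        exact Filter.Eventually.of_forall fun l => TS_nonneg _ _ _ _
  have hSne : S.Nonempty := ⟨_, Unit, {()}, fun _ => i₀, fun _ => 1, by simp, by simp, rfl⟩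
  have hSb : BddBelow S := ⟨ν * v, fun q hq => hSl q hq⟩
  set v₀ := sInf S with hv₀
  have hv₀p : 0 < v₀ := (mul_pos hν hv).trans_le (le_csInf hSne hSl)
  set R := ρ.real Set.univ with hR
  have hR0 : 0 ≤ R := measureReal_nonneg
  have hvar : ∀ i, Var[f i; P] = R := by
    intro i
    rw [← covariance_self (h.meas i).aemeasurable, h.cov]
    simp [hR]
  set e := min (1/2) (v₀ / (4 * (v₀ + 1 + R))) with he
  have he0 : 0 < e := by positivity
  have he1 : e ≤ 1/2 := min_le_left _ _
  have he2 : e * (4 * (v₀ + 1 + R)) ≤ v₀ := by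
    rw [← le_div_iff₀ (by positivity)]; exact min_le_right _ _
  obtain ⟨q, hqS, hqlt⟩ := exists_lt_of_csInf_lt hSne (show sInf S < v₀ + e^2 by
    rw [← hv₀]; have := pow_pos he0 2; linarith)
  have hqv : v₀ ≤ q := csInf_le hSb hqS
  obtain ⟨κ, s, u, w, hw, hw1, hqX⟩ := hqS
  set X : Ω → ℝ := fun ω => ∑ i ∈ s, w i * f (u i) ω with hX
  have hXm : Measurable X := Finset.measurable_fun_sum _ fun i _ => (h.meas _).const_mul _
  have hXL : MemLp X 2 P := memLp_finsetSum _ fun j _ => (h.memLp _).const_mul _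
  refine pos_core h s u w q (v₀ / 4) ((q + R) / 2) (by linarith) (by linarith) hqX ?_ ?_ hbdd
  · intro t
    have hmem : Var[fun ω => e * f t ω + (1 - e) * X ω; P] ∈ S := by
      refine ⟨Option κ, Finset.insertNone s, fun o => o.elim t u, fun o => o.elim e (fun i => (1-e) * w i), ?_, ?_, ?_⟩
      · intro o ho
        rcases o with _ | i
        · exact he0.le
        · simp only [Finset.some_mem_insertNone] at ho
          exact mul_nonneg (by linarith) (hw i ho)
      · rw [Finset.sum_insertNone]
        simp only [Option.elim]
        rw [← Finset.mul_sum, hw1]; ring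
      · congr 1
        funext ω
        rw [Finset.sum_insertNone]
        simp only [Option.elim, hX, Finset.mul_sum, mul_assoc]
    have h1 := csInf_le hSb hmem
    rw [← hv₀, variance_fun_add ((h.memLp t).const_mul _) (hXL.const_mul _), variance_const_mul, variance_const_mul,
      covariance_const_mul_left, covariance_const_mul_right, hvar, ← hqX] at h1
    set H := cov[f t, X; P]
    have h2 : (1-e)^2 * q ≤ (1-e)^2 * (v₀ + e^2) := by gcongr
    have h3 : (1-e)^2 ≤ 1 := by nlinarith
    have h5 : (1-e)^2 * e^2 ≤ e^2 := by nlinarith [sq_nonneg e]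
    -- v0 (2e - e^2) ≤ e^2 + 2 e (1-e) H + e^2 R
    have h4 : e * (v₀ * (2 - e)) ≤ e * (e + 2 * (1-e) * H + e * R) := by nlinarith
    have h6 := le_of_mul_le_mul_left h4 he0
    have h7 : v₀ ≤ 2 * (1-e) * H := by nlinarith
    have h8 : 0 < H := by
      by_contra hn
      push Not at hn
      nlinarith
    nlinarith
  · intro t
    have h1 := variance_nonneg (fun ω => f t ω - X ω) P
    rw [variance_fun_sub (h.memLp t) hXL, hvar, ← hqX] at h1
    linarith
end secK

section secL
variable {ι Ω : Type} [MeasurableSpace Ω] {τ : ι → ℝ} {ρ : Measure ℝ} {P : Measure Ω}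
    {f : ι → Ω → ℝ} [IsFiniteMeasure ρ] [IsProbabilityMeasure P]

lemma AB_gen (h : GP τ ρ P f) (s : ℝ) (hs : 0 < s) (E : Set ℝ)
    (hsub : E ⊆ Set.Icc (-(π / s)) (π / s)) (hE : 0 < volume.real E) (ν : ℝ) (hν : 0 < ν)
    (hρ : (ENNReal.ofReal ν) • volume.restrict E ≤ ρ) (p : ℝ → ℝ) (V γ A : ℝ) (hV : 0 < V)
    (hp : ∀ N : ℝ, 0 < ⌊N/s⌋₊ → 0 < p N)
    (hK : ∀ N : ℝ, 0 < ⌊N/s⌋₊ → ∃ (K : ℕ) (u : Fin ⌊N/s⌋₊ → Fin K → ι), 0 < K ∧ (K:ℝ) ≤ 2 * (⌊N/s⌋₊:ℝ)^A ∧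
      (∀ i j, τ (u i j) = s * (i : ℝ) + s / K * ((j:ℝ) + 1)) ∧
      (p N ≤ (P {ω | ∀ i j, 0 < f (u i j) ω}).toReal) ∧
      ∫ l, TS (Finset.range (⌊N/s⌋₊*K)) (fun _ => 1) (fun i => s/K * (i:ℝ)) l / ((⌊N/s⌋₊*K : ℕ):ℝ)^2 ∂ρ
        ≤ V / (⌊N/s⌋₊:ℝ)^γ) :
    AB (fun n q => ∃ N : ℝ, n = ⌊N/s⌋₊ ∧ q = p N) V (ν * (volume.real E / 2))
      (volume.real E / 2 * s / (2 * π)) A γ := by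
  rintro n q hn ⟨N, hnN, rfl⟩
  refine ⟨hp N (hnN ▸ hn), fun m hm x θ b hx hθ hB => ?_⟩
  have hK := hK N
  rw [← hnN] at hK
  obtain ⟨K, u, hK0, hK2, hu, hpu, hVar⟩ := hK hn
  have hn' : (0:ℝ) < n := by exact_mod_cast hn
  have h1 := union_bound h s hs E hsub hE ν hν hρ n hn m (by
    have hpi := Real.pi_pos
    calc (2 * π / s) * m ≤ (2 * π / s) * (volume.real E / 2 * s / (2 * π) * n) := by gcongr
      _ = _ := by field_simp) K hK0 u hu (V / (n:ℝ)^γ) (by positivity) hVar x hx θ hθ _ hB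
  have h2 : (K:ℝ≥0∞) * (ENNReal.ofReal (Real.exp (θ * (n * x))) * ENNReal.ofReal (Real.exp b) ^ m)
      = ENNReal.ofReal (K * (Real.exp (θ * (n * x)) * Real.exp b ^ m)) := by
    rw [ENNReal.ofReal_mul (by positivity), ENNReal.ofReal_mul (by positivity),
      ENNReal.ofReal_pow (by positivity), ENNReal.ofReal_natCast]
  rw [h2, ← ENNReal.ofReal_add (by positivity) (by positivity)] at h1
  refine hpu.trans ((ENNReal.toReal_le_of_le_ofReal (by positivity) h1).trans ?_)
  have e : -x^2/(2*(V / (n:ℝ)^γ)) = -(x^2 * (n:ℝ)^γ/(2*V)) := by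
    have : (0:ℝ) < (n:ℝ)^γ := by positivity
    field_simp
  rw [e]
  gcongr
end secL

lemma specMom_min (ρ : Measure ℝ) (h1 : ρ Set.univ = 1) (γ : ℝ) (h0 : 0 ≤ γ) (hγ : specMom ρ (-γ) < ⊤) :
    specMom ρ (-(min γ 2)) < ⊤ := by
  have h2 : specMom ρ (-(min γ 2)) ≤ specMom ρ (-γ) + 1 := by
    unfold specMom
    rw [← h1, ← lintegral_one, ← lintegral_add_right _ measurable_const]
    refine lintegral_mono fun l => ?_
    simp only
    rcases le_total (ENNReal.ofReal |l|) 1 with h | h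
    · exact (ENNReal.rpow_le_rpow_of_exponent_ge h (neg_le_neg (min_le_left _ _))).trans le_self_add
    · refine le_trans ?_ le_add_self
      rcases (le_min h0 (by norm_num : (0:ℝ) ≤ 2)).eq_or_lt with h3 | h3
      · rw [← h3]; simp
      · exact ENNReal.rpow_le_one_of_one_le_of_neg h (by linarith)
  exact h2.trans_lt (by simp [hγ])

lemma dom_le (ρ : Measure ℝ) (ν : ℝ) (E : Set ℝ)
    (h : ∀ A : Set ℝ, MeasurableSet A → ENNReal.ofReal ν * volume (A ∩ E) ≤ ρ A) :
    (ENNReal.ofReal ν) • volume.restrict E ≤ ρ := by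
  refine Measure.le_iff.2 fun A hA => ?_
  rw [Measure.smul_apply, Measure.restrict_apply hA, smul_eq_mul]
  exact h A hA

lemma thmZ (Ω : Type) (_ : MeasurableSpace Ω) (P : Measure Ω) (ρ : Measure ℝ)
        (f : ℤ → Ω → ℝ) (hf : IsGSPZ ρ P f) (h1 : ρ Set.univ = 1) 
        (ν : ℝ) (E : Set ℝ) (hν : 0 < ν) (hEm : MeasurableSet E) (hEb : Bornology.IsBounded E)
        (hE : 0 < volume E)
        (hdom : ∀ A : Set ℝ, MeasurableSet A → ENNReal.ofReal ν * volume (A ∩ E) ≤ ρ A)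
        (γ : ℝ) (hγ0 : 0 ≤ γ) (hγ : specMom ρ (-γ) < ⊤) :
        ∃ N₀ C : ℝ, 0 < N₀ ∧ 0 < C ∧
          ∀ N : ℝ, N₀ < N →
            (γ < 1 → Real.log (persZ P f N) ≤ -C * N ^ γ * Real.log N) ∧
            (γ = 1 → Real.log (persZ P f N) ≤ -C * N) ∧
            (1 < γ → Real.log (persZ P f N) ≤ -C * (γ - 1) * N * Real.log N) := by
  obtain ⟨hfin, -, hsupp, hprob, hmeas, hlaw⟩ := hf
  have hg : GP (fun n : ℤ => (n:ℝ)) ρ P f := ⟨hmeas, hlaw⟩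
  -- shrink E
  set E' := E ∩ Set.Icc (-π) π with hE'
  have hE'm : MeasurableSet E' := hEm.inter measurableSet_Icc
  have hE'f : volume E' < ⊤ := (measure_mono Set.inter_subset_right).trans_lt (by simp)
  have hE'p : 0 < volume E' := by
    have h2 := hdom _ (measurableSet_Icc (a := -π) (b := π)).compl
    rw [hsupp] at h2
    have h3 : volume ((Set.Icc (-π) π)ᶜ ∩ E) = 0 := by
      have := mul_eq_zero.1 (nonpos_iff_eq_zero.1 h2)
      rcases this with h | h
      · simp at h; linarith
      · exact h
    refine pos_iff_ne_zero.2 fun h4 => hE.ne' ?_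
    refine measure_mono_null (t := E' ∪ ((Set.Icc (-π) π)ᶜ ∩ E)) ?_ (measure_union_null h4 h3)
    intro l hl
    by_cases hc : l ∈ Set.Icc (-π) π
    · exact Or.inl ⟨hl, hc⟩
    · exact Or.inr ⟨hc, hl⟩
  have hE'r : 0 < volume.real E' := ENNReal.toReal_pos hE'p.ne' hE'f.ne
  have hρ : (ENNReal.ofReal ν) • volume.restrict E' ≤ ρ := dom_le ρ ν E' fun A hA =>
    le_trans (by gcongr; exact Set.inter_subset_left) (hdom A hA)
  have hm' := specMom_min ρ h1 γ hγ0 hγ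
  set γ' := min γ 2 with hγ'
  have hγ'0 : 0 ≤ γ' := le_min hγ0 (by norm_num)
  have hγ'2 : γ' ≤ 2 := min_le_right _ _
  set V := π ^ γ' * (specMom ρ (-γ')).toReal + 1 with hV
  have hVp : 0 < V := by
    have := Real.pi_pos
    positivity
  refine asym_final (persZ P f) 1 one_pos hVp (by positivity) (β := volume.real E' / 2 * 1 / (2 * π))
    (by have := Real.pi_pos; positivity) le_rfl hγ0
    (AB_gen hg 1 one_pos E' (by simp [hE']) hE'r ν hν hρ (persZ P f) V γ' 0 hVp ?_ ?_)
  · intro N hN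
    have hN1 : 1 ≤ N := by
      rw [div_one] at hN; exact (Nat.floor_pos.1 hN)
    let ι := {n : ℤ // 0 < n ∧ (n:ℝ) ≤ N}
    have hgi : GP (fun n : ι => ((n : ℤ):ℝ)) ρ P (fun n : ι => f n) :=
      ⟨fun i => hmeas _, fun n t a => hlaw n (fun i => t i) a⟩
    have hfi : Finite ι := by
      have : {n : ℤ | 0 < n ∧ (n:ℝ) ≤ N} ⊆ Set.Icc 0 ⌊N⌋ := fun n hn => ⟨hn.1.le, Int.le_floor.2 hn.2⟩
      exact ((Set.finite_Icc _ _).subset this).to_subtype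
    have := pos_prob hgi N (by linarith) (fun i => ⟨by exact_mod_cast i.2.1.le, i.2.2⟩) E' hE'm hE'f hE'p
      ν hν hρ (Filter.Eventually.of_forall fun ω => (Set.finite_range _).bddBelow)
    unfold persZ
    refine ENNReal.toReal_pos ?_ (measure_ne_top _ _)
    refine (this.trans_le (measure_mono ?_)).ne'
    intro ω hω n h2 h3
    have := hω ⟨n, h2, h3⟩
    simp only at this
    linarith
  · intro N hN
    refine ⟨1, fun i _ => (i:ℤ) + 1, one_pos, by norm_num, ?_, ?_, ?_⟩
    · intro i j
      simp [Subsingleton.elim j 0]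
    · unfold persZ
      refine ENNReal.toReal_mono (measure_ne_top _ _) (measure_mono fun ω hω i j => ?_)
      refine hω _ (by positivity) ?_
      have h2 : (i:ℕ) + 1 ≤ ⌊N/1⌋₊ := i.2
      have h3 := (Nat.le_floor_iff' (by omega)).1 h2
      have h4 : N / 1 = N := div_one N
      push_cast at h3 ⊢
      linarith
    · set n := ⌊N/1⌋₊ with hn
      have hn' : (0:ℝ) < n := by exact_mod_cast hN
      have h2 := var_bound ρ n hN 1 one_pos γ' hγ'0 hγ'2
      have h3 : ρ {l | π / 1 < |l|} = 0 := by
        refine measure_mono_null ?_ hsupp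
        intro l hl hl2
        rw [div_one] at hl
        exact absurd (abs_le.2 hl2) (not_le.2 hl)
      rw [h3, add_zero, mul_one] at h2
      have hpi := Real.pi_pos
      rw [ENNReal.ofReal_rpow_of_pos (by positivity), ← ENNReal.ofReal_toReal hm'.ne,
        ← ENNReal.ofReal_mul (by positivity), ENNReal.ofReal_le_ofReal_iff (by positivity)] at h2
      simp only [mul_one, Nat.cast_one, div_one]
      refine h2.trans ?_
      rw [Real.div_rpow hpi.le hn'.le, div_mul_eq_mul_div]
      gcongr
      linarith

lemma thmR (Ω : Type) (_ : MeasurableSpace Ω) (P : Measure Ω) (ρ : Measure ℝ)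
        (f : ℝ → Ω → ℝ) (hf : IsGSPR ρ P f) (h1 : ρ Set.univ = 1)
        (δ : ℝ) (hδ : 0 < δ) (hδm : specMom ρ δ < ⊤)
        (ν : ℝ) (E : Set ℝ) (hν : 0 < ν) (hEm : MeasurableSet E) (hEb : Bornology.IsBounded E)
        (hE : 0 < volume E)
        (hdom : ∀ A : Set ℝ, MeasurableSet A → ENNReal.ofReal ν * volume (A ∩ E) ≤ ρ A)
        (γ : ℝ) (hγ0 : 0 ≤ γ) (hγ : specMom ρ (-γ) < ⊤) :
        ∃ N₀ C : ℝ, 0 < N₀ ∧ 0 < C ∧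
          ∀ N : ℝ, N₀ < N →
            (γ < 1 → Real.log (persR P f N) ≤ -C * N ^ γ * Real.log N) ∧
            (γ = 1 → Real.log (persR P f N) ≤ -C * N) ∧
            (1 < γ → Real.log (persR P f N) ≤ -C * (γ - 1) * N * Real.log N) := by
  obtain ⟨hfin, -, hprob, hmeas2, hcont, hlaw⟩ := hf
  have hmeas : ∀ t, Measurable (f t) := fun t => hmeas2.comp measurable_prodMk_left
  have hg : GP (fun t : ℝ => t) ρ P f := ⟨hmeas, hlaw⟩
  have hpi := Real.pi_pos
  have hEf : volume E < ⊤ := hEb.measure_lt_top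
  have hEr : 0 < volume.real E := ENNReal.toReal_pos hE.ne' hEf.ne
  have hρ := dom_le ρ ν E hdom
  obtain ⟨R, hR0, hR⟩ := hEb.exists_pos_norm_le
  set s := π / R with hs
  have hsp : 0 < s := by positivity
  have hsR : π / s = R := by rw [hs]; field_simp
  have hm' := specMom_min ρ h1 γ hγ0 hγ
  set γ' := min γ 2 with hγ'
  have hγ'0 : 0 ≤ γ' := le_min hγ0 (by norm_num)
  have hγ'2 : γ' ≤ 2 := min_le_right _ _
  set V := (π / s) ^ γ' * (specMom ρ (-γ')).toReal + (s / π) ^ δ * (specMom ρ δ).toReal + 1 with hV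
  have hVp : 0 < V := by positivity
  refine asym_final (persR P f) s hsp hVp (by positivity) (β := volume.real E / 2 * s / (2 * π))
    (by positivity) (A := γ' / δ) (by positivity) hγ0
    (AB_gen hg s hsp E ?_ hEr ν hν hρ (persR P f) V γ' (γ' / δ) hVp ?_ ?_)
  · intro l hl
    rw [hsR]
    exact abs_le.1 (hR l hl)
  · intro N hN
    have hN1 : 0 < N := by
      have := Nat.floor_pos.1 hN
      rw [le_div_iff₀ hsp] at this
      linarith
    let ι := {q : ℚ // 0 < (q:ℝ) ∧ (q:ℝ) ≤ N}
    have hgi : GP (fun q : ι => ((q : ℚ):ℝ)) ρ P (fun q : ι => f (q:ℚ)) :=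
      ⟨fun i => hmeas _, fun n t a => hlaw n (fun i => ((t i : ℚ):ℝ)) a⟩
    have hbdd : ∀ᵐ ω ∂P, BddBelow (Set.range fun q : ι => f (q:ℚ) ω) := by
      filter_upwards [hcont] with ω hω
      refine ((isCompact_Icc (a := (0:ℝ)) (b := N)).image hω).bddBelow.mono ?_
      rintro _ ⟨q, rfl⟩
      exact ⟨_, ⟨q.2.1.le, q.2.2⟩, rfl⟩
    have := pos_prob hgi N hN1.le (fun i => ⟨i.2.1.le, i.2.2⟩) E hEm hEf hE
      ν hν hρ hbdd
    unfold persR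
    refine ENNReal.toReal_pos ?_ (measure_ne_top _ _)
    refine (this.trans_le (measure_mono_ae ?_)).ne'
    filter_upwards [hcont] with ω hω hω1 t ht
    by_contra hn
    push Not at hn
    obtain ⟨ε, hε, hb⟩ := Metric.continuousAt_iff.1 (hω.continuousAt (x := t)) 1 one_pos
    obtain ⟨q, hq1, hq2⟩ := exists_rat_btwn (show max 0 (t - ε) < t from max_lt ht.1 (by linarith))
    have h3 := hb (x := (q:ℝ)) (by
      rw [Real.dist_eq, abs_lt]
      have := (le_max_right 0 (t - ε)).trans_lt hq1
      constructor <;> linarith)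
    have h4 : 1 ≤ f (q:ℝ) ω := hω1 ⟨q, (le_max_left _ _).trans_lt hq1, hq2.le.trans ht.2⟩
    rw [Real.dist_eq, abs_lt] at h3
    linarith [h3.2]
  · intro N hN
    have hN1 : (⌊N/s⌋₊:ℝ) * s ≤ N := by
      rw [← le_div_iff₀ hsp]
      exact Nat.floor_le (by by_contra hc; push Not at hc; rw [Nat.floor_of_nonpos hc.le] at hN; omega)
    generalize ⌊N/s⌋₊ = n at hN hN1
    have hn' : (0:ℝ) < n := by exact_mod_cast hN
    have hn1 : (1:ℝ) ≤ n := by exact_mod_cast hN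
    have hA1 : (1:ℝ) ≤ (n:ℝ)^(γ'/δ) := Real.one_le_rpow hn1 (by positivity)
    obtain ⟨K, hK⟩ : ∃ K : ℕ, K = ⌈(n:ℝ)^(γ'/δ)⌉₊ := ⟨_, rfl⟩
    have hKge : (n:ℝ)^(γ'/δ) ≤ K := by rw [hK]; exact Nat.le_ceil _
    have hKle : (K:ℝ) ≤ (n:ℝ)^(γ'/δ) + 1 := by rw [hK]; exact (Nat.ceil_lt_add_one (by positivity)).le
    have hK0' : (0:ℝ) < K := by linarith
    have hK0 : 0 < K := by exact_mod_cast hK0'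
    refine ⟨K, fun i j => s * (i:ℝ) + s / K * ((j:ℝ) + 1), hK0, by linarith, fun i j => rfl, ?_, ?_⟩
    · unfold persR
      refine ENNReal.toReal_mono (measure_ne_top _ _) (measure_mono fun ω hω i j => ?_)
      refine hω _ ⟨by positivity, ?_⟩
      have h2 : (i:ℝ) + 1 ≤ n := by exact_mod_cast i.2
      have h3 : (j:ℝ) + 1 ≤ K := by exact_mod_cast j.2
      calc s * (i:ℝ) + s / K * ((j:ℝ) + 1) ≤ s * i + s / K * K := by gcongr
        _ = s * (i + 1) := by field_simp
        _ ≤ s * n := by gcongr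
        _ ≤ N := by linarith
    · have h2 := var_bound ρ (n*K) (by positivity) (s/K) (by positivity) γ' hγ'0 hγ'2
      have h3 := tail_mom ρ δ hδ (s/K) (by positivity)
      have h4 := h2.trans (add_le_add_right h3 _)
      have e1 : π / (((n*K : ℕ):ℝ) * (s/K)) = π / s / n := by push_cast; field_simp
      have e2 : s / K / π = s / π / K := by field_simp
      rw [e1, e2, ENNReal.ofReal_rpow_of_pos (by positivity), ENNReal.ofReal_rpow_of_pos (by positivity),
        ← ENNReal.ofReal_toReal hm'.ne, ← ENNReal.ofReal_toReal hδm.ne,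
        ← ENNReal.ofReal_mul (by positivity), ← ENNReal.ofReal_mul (by positivity),
        ← ENNReal.ofReal_add (by positivity) (by positivity),
        ENNReal.ofReal_le_ofReal_iff (by positivity)] at h4
      refine h4.trans ?_
      rw [Real.div_rpow (by positivity) hn'.le, Real.div_rpow (x := s / π) (by positivity) hK0'.le]
      have h5 : (n:ℝ)^γ' ≤ (K:ℝ)^δ := by
        calc (n:ℝ)^γ' = ((n:ℝ)^(γ'/δ))^δ := by
              rw [← Real.rpow_mul hn'.le, div_mul_cancel₀ _ hδ.ne']
          _ ≤ _ := by gcongr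
      have hnp : 0 < (n:ℝ)^γ' := by positivity
      calc (π/s)^γ' / (n:ℝ)^γ' * (specMom ρ (-γ')).toReal + (s/π)^δ / (K:ℝ)^δ * (specMom ρ δ).toReal
          ≤ (π/s)^γ' / (n:ℝ)^γ' * (specMom ρ (-γ')).toReal + (s/π)^δ / (n:ℝ)^γ' * (specMom ρ δ).toReal := by
            gcongr
        _ = ((π/s)^γ' * (specMom ρ (-γ')).toReal + (s/π)^δ * (specMom ρ δ).toReal) / (n:ℝ)^γ' := by ring
        _ ≤ _ := by gcongr; linarith

/-- **Explicit upper bounds (Corollary 2.5).** Let `f` be a normalized GSP on `ℤ` or `ℝ`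
with some finite positive moment, whose spectral measure has a nontrivial absolutely
continuous component (`dρ ≥ ν·1_E dλ` with `ν > 0` and `E` bounded measurable of positive
Lebesgue measure), and with `m_{-γ} < ∞` for some `γ ≥ 0`. Then there are `N₀, C > 0` such
that for all `N > N₀`: if `γ < 1` then `log P_f(N) ≤ -C·N^γ·log N`; if `γ = 1` then
`log P_f(N) ≤ -C·N`; and if `γ > 1` then `log P_f(N) ≤ -C·(γ-1)·N·log N`. -/
theorem statement5 :
    (∀ (Ω : Type) (_ : MeasurableSpace Ω) (P : Measure Ω) (ρ : Measure ℝ)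
        (f : ℤ → Ω → ℝ), IsGSPZ ρ P f → ρ Set.univ = 1 →
        (∃ δ : ℝ, 0 < δ ∧ specMom ρ δ < ⊤) →
        ∀ (ν : ℝ) (E : Set ℝ), 0 < ν → MeasurableSet E → Bornology.IsBounded E →
        0 < volume E →
        (∀ A : Set ℝ, MeasurableSet A → ENNReal.ofReal ν * volume (A ∩ E) ≤ ρ A) →
        ∀ γ : ℝ, 0 ≤ γ → specMom ρ (-γ) < ⊤ →
        ∃ N₀ C : ℝ, 0 < N₀ ∧ 0 < C ∧
          ∀ N : ℝ, N₀ < N →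
            (γ < 1 → Real.log (persZ P f N) ≤ -C * N ^ γ * Real.log N) ∧
            (γ = 1 → Real.log (persZ P f N) ≤ -C * N) ∧
            (1 < γ → Real.log (persZ P f N) ≤ -C * (γ - 1) * N * Real.log N)) ∧
    (∀ (Ω : Type) (_ : MeasurableSpace Ω) (P : Measure Ω) (ρ : Measure ℝ)
        (f : ℝ → Ω → ℝ), IsGSPR ρ P f → ρ Set.univ = 1 →
        (∃ δ : ℝ, 0 < δ ∧ specMom ρ δ < ⊤) →
        ∀ (ν : ℝ) (E : Set ℝ), 0 < ν → MeasurableSet E → Bornology.IsBounded E →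
        0 < volume E →
        (∀ A : Set ℝ, MeasurableSet A → ENNReal.ofReal ν * volume (A ∩ E) ≤ ρ A) →
        ∀ γ : ℝ, 0 ≤ γ → specMom ρ (-γ) < ⊤ →
        ∃ N₀ C : ℝ, 0 < N₀ ∧ 0 < C ∧
          ∀ N : ℝ, N₀ < N →
            (γ < 1 → Real.log (persR P f N) ≤ -C * N ^ γ * Real.log N) ∧
            (γ = 1 → Real.log (persR P f N) ≤ -C * N) ∧
            (1 < γ → Real.log (persR P f N) ≤ -C * (γ - 1) * N * Real.log N)) := by
  refine ⟨?_, ?_⟩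
  · intro Ω mΩ P ρ f hf h1 _ ν E hν hEm hEb hE hdom γ hγ0 hγ
    exact thmZ Ω mΩ P ρ f hf h1 ν E hν hEm hEb hE hdom γ hγ0 hγ
  · intro Ω mΩ P ρ f hf h1 hδ ν E hν hEm hEb hE hdom γ hγ0 hγ
    obtain ⟨δ, hδ0, hδm⟩ := hδ
    exact thmR Ω mΩ P ρ f hf h1 δ hδ0 hδm ν E hν hEm hEb hE hdom γ hγ0 hγ

end
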